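/- arXiv:1712.06155 — 2 statements merged into one kernel-verified Lean document; each statement's English description precedes it below -/
import Mathlib

section
/- Assume that for every k with 1 ≤ k ≤ n, every GC_k set possesses a maximal line. Let X be a GC_n set with n ≥ 4 that has exactly three maximal lines. Then X has exactly three n-node lines, and each of these n-node lines is used by exactly binom(n,2) = n(n-1)/2 nodes of X. -/
open MvPolynomial

/-- Points of the plane `ℝ²`. -/
abbrev Pt : Type := Fin 2 → ℝ

/-- Bivariate real polynomials. -/
abbrev BPoly : Type := MvPolynomial (Fin 2) ℝ

/-- `X` is an `n`-poised node set: it has `N = (n+1)(n+2)/2` nodes and every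
interpolation problem with polynomials of total degree at most `n` has a unique solution. -/
def IsPoised (n : ℕ) (X : Set Pt) : Prop :=
  X.ncard = (n + 1) * (n + 2) / 2 ∧
  ∀ c : Pt → ℝ, ∃! p : BPoly, p.totalDegree ≤ n ∧ ∀ A ∈ X, eval A p = c A

/-- `p` is an `n`-fundamental polynomial of the node `A` for the node set `X`. -/
def IsFund (n : ℕ) (X : Set Pt) (A : Pt) (p : BPoly) : Prop :=
  p.totalDegree ≤ n ∧ eval A p = 1 ∧ ∀ B ∈ X, B ≠ A → eval B p = 0

/-- `X` is a `GC_n` set: it is `n`-poised and each node has a fundamental polynomial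
that is a product of `n` polynomials of degree `1`. -/
def IsGC (n : ℕ) (X : Set Pt) : Prop :=
  IsPoised n X ∧
  ∀ A ∈ X, ∃ p : BPoly, IsFund n X A p ∧
    ∃ f : Fin n → BPoly, (∀ i, (f i).totalDegree = 1) ∧ p = ∏ i, f i

/-- A line is the zero set of a polynomial of degree exactly `1`. -/
def IsLine (L : Set Pt) : Prop :=
  ∃ f : BPoly, f.totalDegree = 1 ∧ L = {x : Pt | eval x f = 0}

/-- A `k`-node line of `X`: a line passing through exactly `k` nodes of `X`. -/
def IsNodeLine (k : ℕ) (X : Set Pt) (L : Set Pt) : Prop :=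
  IsLine L ∧ (X ∩ L).ncard = k

/-- A maximal line of an `n`-poised set `X`: an `(n+1)`-node line. -/
def IsMaxLine (n : ℕ) (X : Set Pt) (L : Set Pt) : Prop :=
  IsNodeLine (n + 1) X L

/-- The node `A` uses the line `L`: a degree-1 polynomial whose zero set is `L`
divides the `n`-fundamental polynomial of `A` with respect to `X`. -/
def Uses (n : ℕ) (X : Set Pt) (L : Set Pt) (A : Pt) : Prop :=
  ∃ p f : BPoly, IsFund n X A p ∧ f.totalDegree = 1 ∧ L = {x : Pt | eval x f = 0} ∧ f ∣ p

/-- `X_ℓ`: the set of nodes of `X` that use the line `L`. -/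
def UseSet (n : ℕ) (X : Set Pt) (L : Set Pt) : Set Pt :=
  {A ∈ X | Uses n X L A}


theorem exists_affine_of_totalDegree_eq_one {f : BPoly} (hf : f.totalDegree = 1) :
    ∃ a b c : ℝ, (a ≠ 0 ∨ b ≠ 0) ∧ f = C a * X 0 + C b * X 1 + C c := by
  have key : f = C (coeff (Finsupp.single 0 1) f) * X 0
      + C (coeff (Finsupp.single 1 1) f) * X 1 + C (coeff 0 f) := by
    ext m
    by_cases hm : 1 < m.degree
    · have h1 : coeff m f = 0 := by
        apply coeff_eq_zero_of_totalDegree_lt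
        rw [hf]
        exact hm
      have h2 : ∀ i : Fin 2, Finsupp.single i 1 ≠ m := by
        rintro i rfl
        simp [Finsupp.degree_single] at hm
      have h3 : (0 : Fin 2 →₀ ℕ) ≠ m := by
        rintro rfl
        simp at hm
      rw [h1, coeff_add, coeff_add, coeff_C_mul, coeff_C_mul, coeff_X, coeff_X, coeff_C]
      simp [h2, h3]
    · have hm' : m = 0 ∨ m = Finsupp.single 0 1 ∨ m = Finsupp.single 1 1 := by
        have h4 : m 0 + m 1 ≤ 1 := by
          have h5 := Finsupp.degree_eq_sum m
          rw [Fin.sum_univ_two] at h5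
          omega
        have h6 : (m 0 = 0 ∧ m 1 = 0) ∨ (m 0 = 1 ∧ m 1 = 0) ∨ (m 0 = 0 ∧ m 1 = 1) := by omega
        rcases h6 with ⟨h, h'⟩ | ⟨h, h'⟩ | ⟨h, h'⟩
        · left; ext i; fin_cases i <;> simp [h, h']
        · right; left; ext i; fin_cases i <;> simp [h, h']
        · right; right; ext i; fin_cases i <;> simp [h, h']
      have e1 : (Finsupp.single (0 : Fin 2) 1 : Fin 2 →₀ ℕ) ≠ Finsupp.single 1 1 := by
        intro h
        simpa using DFunLike.congr_fun h 0
      have e2 : ∀ i : Fin 2, (0 : Fin 2 →₀ ℕ) ≠ Finsupp.single i 1 := by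
        intro i h
        simpa using DFunLike.congr_fun h i
      rcases hm' with rfl | rfl | rfl <;>
      · rw [coeff_add, coeff_add, coeff_C_mul, coeff_C_mul, coeff_X, coeff_X, coeff_C]
        simp [e1, e1.symm, e2]
  refine ⟨_, _, _, ?_, key⟩
  by_contra! h
  rw [h.1, h.2] at key
  simp only [map_zero, zero_mul, zero_add] at key
  rw [key, totalDegree_C] at hf
  exact zero_ne_one hf

theorem dvd_of_vanishing {f p : BPoly} (hf : f.totalDegree = 1) {d : ℕ}
    (hp : p.totalDegree ≤ d) {S : Set Pt} (hS : d + 1 ≤ S.ncard)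
    (hSf : ∀ x ∈ S, eval x f = 0) (hSp : ∀ x ∈ S, eval x p = 0) : f ∣ p := by
  obtain ⟨a, b, c, hab, rfl⟩ := exists_affine_of_totalDegree_eq_one hf
  have hS0 : S.Nonempty := Set.nonempty_of_ncard_ne_zero (by omega)
  obtain ⟨P, hP⟩ := hS0
  have hN : a ^ 2 + b ^ 2 ≠ 0 := by
    rcases hab with h | h <;> positivity
  have hPf : a * P 0 + b * P 1 + c = 0 := by simpa using hSf P hP
  set s : MvPolynomial (Fin 2) ℝ →ₐ[ℝ] Polynomial ℝ :=
    aeval ![Polynomial.C (-b) * Polynomial.X + Polynomial.C (P 0),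
      Polynomial.C a * Polynomial.X + Polynomial.C (P 1)] with hs
  set t : BPoly := C ((a ^ 2 + b ^ 2)⁻¹) * (C (-b) * (X 0 - C (P 0)) + C a * (X 1 - C (P 1)))
    with ht
  have hdeg : (s p).natDegree ≤ d := by
    have := MvPolynomial.aeval_natDegree_le p hp
      ![Polynomial.C (-b) * Polynomial.X + Polynomial.C (P 0),
      Polynomial.C a * Polynomial.X + Polynomial.C (P 1)] (n := 1) (by
        intro i
        fin_cases i
        · exact Polynomial.natDegree_linear_le
        · exact Polynomial.natDegree_linear_le)
    simpa [hs] using this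
  have heval : ∀ x : Pt, a * x 0 + b * x 1 + c = 0 →
      (s p).eval (eval x t) = eval x p := by
    intro x hx
    have h1 : (Polynomial.evalRingHom (eval x t)).comp s.toRingHom = eval x := by
      apply MvPolynomial.ringHom_ext
      · intro r; simp [hs]
      · intro i
        fin_cases i
        · simp [hs, ht]
          field_simp
          linear_combination a * hPf - a * hx
        · simp [hs, ht]
          field_simp
          linear_combination b * hPf - b * hx
    exact RingHom.congr_fun h1 p
  have hinj : Set.InjOn (fun x : Pt => eval x t) S := by
    intro x hx y hy hxy
    have hx' : a * x 0 + b * x 1 + c = 0 := by simpa using hSf x hx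
    have hy' : a * y 0 + b * y 1 + c = 0 := by simpa using hSf y hy
    simp [ht, hN] at hxy
    have h3 : (a ^ 2 + b ^ 2) * (x 0 - y 0) = 0 := by
      linear_combination (-b) * hxy + a * hx' - a * hy'
    have h4 : (a ^ 2 + b ^ 2) * (x 1 - y 1) = 0 := by
      linear_combination a * hxy + b * hx' - b * hy'
    ext i
    fin_cases i
    · simpa [hN, sub_eq_zero] using h3
    · simpa [hN, sub_eq_zero] using h4
  have hzero : s p = 0 := by
    have hfin : S.Finite := Set.finite_of_ncard_ne_zero (by omega)
    refine Polynomial.eq_zero_of_natDegree_lt_card_of_eval_eq_zero' (s p)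
      (hfin.toFinset.image fun x => eval x t) ?_ ?_
    · intro y hy
      obtain ⟨x, hx, rfl⟩ := Finset.mem_image.1 hy
      rw [Set.Finite.mem_toFinset] at hx
      rw [heval x (by simpa using hSf x hx), hSp x hx]
    · rw [Finset.card_image_of_injOn (by simpa using hinj), ← Set.ncard_eq_toFinset_card S hfin]
      omega
  have hmod : (Ideal.Quotient.mkₐ ℝ (Ideal.span {C a * X 0 + C b * X 1 + C c})).comp
      ((Polynomial.aeval t).comp s) =
      Ideal.Quotient.mkₐ ℝ (Ideal.span {(C a * X 0 + C b * X 1 + C c : BPoly)}) := by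
    have hN' : (C ((a ^ 2 + b ^ 2)⁻¹) : BPoly) * (C a ^ 2 + C b ^ 2) = 1 := by
      rw [← map_pow, ← map_pow, ← map_add, ← map_mul, inv_mul_cancel₀ hN, map_one]
    have hc : (C c : BPoly) = - (C a * C (P 0) + C b * C (P 1)) := by
      rw [← map_mul, ← map_mul, ← map_add, ← map_neg]
      congr 1
      linear_combination hPf
    apply MvPolynomial.algHom_ext
    intro i
    simp only [AlgHom.comp_apply, Ideal.Quotient.mkₐ_eq_mk, Ideal.Quotient.eq,
      Ideal.mem_span_singleton]
    fin_cases i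
    · refine ⟨-C ((a ^ 2 + b ^ 2)⁻¹) * C a, ?_⟩
      simp [hs, ht, MvPolynomial.algebraMap_eq]
      rw [hc]
      linear_combination (X 0 - C (P 0) : BPoly) * hN'
    · refine ⟨-C ((a ^ 2 + b ^ 2)⁻¹) * C b, ?_⟩
      simp [hs, ht, MvPolynomial.algebraMap_eq]
      rw [hc]
      linear_combination (X 1 - C (P 1) : BPoly) * hN'
  have := AlgHom.congr_fun hmod p
  simp only [AlgHom.comp_apply, hzero, map_zero] at this
  rw [← Ideal.mem_span_singleton, ← Ideal.Quotient.eq_zero_iff_mem]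
  exact this.symm

/-- A polynomial of degree at most `d` with `d + 1` zeros on a line is divisible by the line. -/
theorem eq_zero_or_exists_mul_of_vanishing {f p : BPoly} (hf : f.totalDegree = 1) {d : ℕ}
    (hp : p.totalDegree ≤ d) {S : Set Pt} (hS : d + 1 ≤ S.ncard)
    (hSf : ∀ x ∈ S, eval x f = 0) (hSp : ∀ x ∈ S, eval x p = 0) :
    p = 0 ∨ ∃ q, p = f * q ∧ q.totalDegree + 1 ≤ d := by
  obtain ⟨q, rfl⟩ := dvd_of_vanishing hf hp hS hSf hSp
  by_cases h : f * q = 0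
  · exact Or.inl h
  · refine Or.inr ⟨q, rfl, ?_⟩
    rw [totalDegree_mul_of_isDomain (left_ne_zero_of_mul h) (right_ne_zero_of_mul h)] at hp
    omega

theorem zero_of_zero_of_two_common {f g : BPoly} (hf : f.totalDegree = 1) (hg : g.totalDegree = 1)
    {A B : Pt} (hAB : A ≠ B) (hfA : eval A f = 0) (hfB : eval B f = 0) (hgA : eval A g = 0)
    (hgB : eval B g = 0) {x : Pt} (hx : eval x f = 0) : eval x g = 0 := by
  obtain ⟨q, rfl⟩ : f ∣ g := dvd_of_vanishing (d := 1) (S := {A, B}) hf hg.le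
    (by rw [Set.ncard_pair hAB]) (by simp [hfA, hfB]) (by simp [hgA, hgB])
  simp [hx]

theorem IsLine.eq_of_two_common {L L' : Set Pt} (hL : IsLine L) (hL' : IsLine L') {A B : Pt}
    (hAB : A ≠ B) (hA : A ∈ L) (hB : B ∈ L) (hA' : A ∈ L') (hB' : B ∈ L') : L = L' := by
  obtain ⟨f, hf, rfl⟩ := hL
  obtain ⟨g, hg, rfl⟩ := hL'
  ext x
  exact ⟨zero_of_zero_of_two_common hf hg hAB hA hB hA' hB',
    zero_of_zero_of_two_common hg hf hAB hA' hB' hA hB⟩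

theorem IsLine.inter_subsingleton {L L' : Set Pt} (hL : IsLine L) (hL' : IsLine L')
    (h : L ≠ L') : (L ∩ L').Subsingleton := by
  intro A hA B hB
  by_contra hAB
  exact h (hL.eq_of_two_common hL' hAB hA.1 hB.1 hA.2 hB.2)

theorem IsPoised.finite {n : ℕ} {X : Set Pt} (hX : IsPoised n X) : X.Finite := by
  apply Set.finite_of_ncard_ne_zero
  have h : 2 ≤ (n + 1) * (n + 2) := by nlinarith
  rw [hX.1]
  omega

theorem totalDegree_prod_le_card {ι : Type*} (s : Finset ι) {f : ι → BPoly}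
    (hf : ∀ i, (f i).totalDegree = 1) : (∏ i ∈ s, f i).totalDegree ≤ s.card := by
  refine (totalDegree_finsetProd s f).trans ?_
  simp [hf]

theorem IsGC.exists_prod {n : ℕ} {X : Set Pt} (hX : IsGC n X) {A : Pt} (hA : A ∈ X) :
    ∃ f : Fin n → BPoly, (∀ i, (f i).totalDegree = 1) ∧ IsFund n X A (∏ i, f i) := by
  obtain ⟨p, hp, f, hf, rfl⟩ := hX.2 A hA
  exact ⟨f, hf, hp⟩

theorem IsGC.of_exists_prod {n : ℕ} {X : Set Pt} (hX : IsPoised n X)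
    (h : ∀ A ∈ X, ∃ f : Fin n → BPoly, (∀ i, (f i).totalDegree = 1) ∧
      eval A (∏ i, f i) ≠ 0 ∧ ∀ B ∈ X, B ≠ A → eval B (∏ i, f i) = 0) : IsGC n X := by
  refine ⟨hX, fun A hA => ?_⟩
  obtain ⟨f, hf, hfA, hfB⟩ := h A hA
  cases n with
  | zero =>
    refine ⟨∏ i, f i, ⟨by simp, by simp, hfB⟩, f, hf, rfl⟩
  | succ n =>
    set c := (eval A (∏ i, f i))⁻¹ with hc
    have hc0 : c ≠ 0 := inv_ne_zero hfA
    have hdeg : ∀ i, ((Fin.cons (C c * f 0) (fun i => f (Fin.succ i)) : Fin (n + 1) → BPoly)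
        i).totalDegree = 1 := by
      intro i
      refine Fin.cases ?_ (fun j => ?_) i
      · have h0 : f 0 ≠ 0 := by
          intro h0
          simpa [h0] using hf 0
        rw [Fin.cons_zero, totalDegree_mul_of_isDomain (by simpa using hc0) h0, hf]
        simp
      · rw [Fin.cons_succ]
        exact hf _
    have hprod : ∏ i, (Fin.cons (C c * f 0) (fun i => f (Fin.succ i)) : Fin (n + 1) → BPoly) i =
        C c * ∏ i, f i := by
      rw [Fin.prod_univ_succ, Fin.prod_univ_succ, Fin.cons_zero]
      simp only [Fin.cons_succ]
      ring
    refine ⟨_, ⟨?_, ?_, ?_⟩, _, hdeg, rfl⟩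
    · simpa using totalDegree_prod_le_card Finset.univ hdeg
    · rw [hprod, map_mul, eval_C, hc, inv_mul_cancel₀ hfA]
    · intro B hB hBA
      rw [hprod, map_mul, hfB B hB hBA, mul_zero]

theorem IsGC.ncard_inter_le {n : ℕ} {X : Set Pt} (hX : IsGC n X) {L : Set Pt} (hL : IsLine L) :
    (X ∩ L).ncard ≤ n + 1 := by
  obtain ⟨f, hf, rfl⟩ := hL
  by_contra! h
  obtain ⟨A, hA⟩ : (X ∩ {x | eval x f = 0}).Nonempty :=
    Set.nonempty_of_ncard_ne_zero (by omega)
  obtain ⟨p, hp, -⟩ := hX.2 A hA.1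
  obtain ⟨q, hq⟩ : f ∣ p := by
    refine dvd_of_vanishing (d := n) (S := (X ∩ {x | eval x f = 0}) \ {A}) hf hp.1 ?_ ?_ ?_
    · have := Set.ncard_sdiff_singleton_of_mem hA
      omega
    · exact fun x hx => hx.1.2
    · exact fun x hx => hp.2.2 x hx.1.1 hx.2
  have h1 := hp.2.1
  rw [hq, map_mul, hA.2, zero_mul] at h1
  exact zero_ne_one h1

theorem IsMaxLine.exists_zero_set_eq {n : ℕ} {X M : Set Pt} (hM : IsMaxLine (n + 1) X M)
    {f : Fin (n + 1) → BPoly} (hf : ∀ i, (f i).totalDegree = 1)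
    (h : ∀ x ∈ X ∩ M, eval x (∏ i, f i) = 0) : ∃ i, M = {x | eval x (f i) = 0} := by
  have hfin : (X ∩ M).Finite := Set.finite_of_ncard_ne_zero (by rw [hM.2]; omega)
  have h' : ∀ x ∈ X ∩ M, ∃ i, eval x (f i) = 0 := by
    intro x hx
    have := h x hx
    rw [map_prod, Finset.prod_eq_zero_iff] at this
    obtain ⟨i, -, hi⟩ := this
    exact ⟨i, hi⟩
  choose! φ hφ using h'
  obtain ⟨A, hA, B, hB, hAB, hE⟩ := Set.exists_ne_map_eq_of_ncard_lt_of_maps_to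
    (t := Set.univ) (s := X ∩ M) (f := φ) (by rw [hM.2, Set.ncard_univ]; simp) (by simp)
  refine ⟨φ A, hM.1.eq_of_two_common ⟨_, hf _, rfl⟩ hAB hA.2 hB.2 (hφ A hA) ?_⟩
  have := hφ B hB
  rwa [← hE] at this

theorem IsGC.diff_maxLine {n : ℕ} {X M : Set Pt} (hX : IsGC (n + 1) X)
    (hM : IsMaxLine (n + 1) X M) : IsGC n (X \ M) := by
  obtain ⟨f, hf, hMf⟩ := hM.1
  have hf0 : f ≠ 0 := by
    rintro rfl
    simp at hf
  have hfX : ∀ x ∈ X \ M, eval x f ≠ 0 := by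
    intro x hx h
    exact hx.2 (by rw [hMf]; exact h)
  have hfM : ∀ x ∈ M, eval x f = 0 := by
    intro x hx
    rw [hMf] at hx
    exact hx
  have hcard : (X \ M).ncard = (n + 1) * (n + 2) / 2 := by
    have h1 := Set.ncard_inter_add_ncard_sdiff_eq_ncard X M hX.1.finite
    have h2 : (n + 1 + 1) * (n + 1 + 2) = (n + 1) * (n + 2) + 2 * (n + 1 + 1) := by ring
    rw [hX.1.1, hM.2, h2] at h1
    omega
  have hfactor : ∀ p : BPoly, p.totalDegree ≤ n + 1 → (∀ x ∈ X ∩ M, eval x p = 0) →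
      ∃ q : BPoly, p = f * q ∧ q.totalDegree ≤ n := by
    intro p hp hpM
    rcases eq_zero_or_exists_mul_of_vanishing hf hp hM.2.ge (fun x hx => hfM x hx.2) hpM with
      rfl | ⟨q, hq, hdeg⟩
    · exact ⟨0, by simp, by simp⟩
    · exact ⟨q, hq, by omega⟩
  refine IsGC.of_exists_prod ⟨hcard, fun c => ?_⟩ ?_
  · classical
    obtain ⟨p, ⟨hp, hpX⟩, hpu⟩ := hX.1.2 (fun x => if x ∈ M then 0 else c x * eval x f)
    obtain ⟨q, rfl, hq⟩ := hfactor p hp (by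
      intro x hx
      rw [hpX x hx.1, if_pos hx.2])
    refine ⟨q, ⟨hq, ?_⟩, ?_⟩
    · intro A hA
      have h1 := hpX A hA.1
      rw [if_neg hA.2, map_mul, mul_comm] at h1
      exact mul_right_cancel₀ (hfX A hA) h1
    · rintro r ⟨hr, hrX⟩
      have h1 : f * r = f * q := by
        refine hpu (f * r) ⟨?_, ?_⟩
        · refine (totalDegree_mul _ _).trans ?_
          omega
        · intro x hx
          split_ifs with hxM
          · rw [map_mul, hfM x hxM, zero_mul]
          · rw [map_mul, hrX x ⟨hx, hxM⟩, mul_comm]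
      exact mul_left_cancel₀ hf0 h1
  · intro A hA
    obtain ⟨g, hg, hgF⟩ := hX.exists_prod hA.1
    obtain ⟨i, hi⟩ := hM.exists_zero_set_eq hg (by
      intro x hx
      refine hgF.2.2 x hx.1 ?_
      rintro rfl
      exact hA.2 hx.2)
    refine ⟨fun j => g (i.succAbove j), fun j => hg _, ?_, ?_⟩
    · intro h
      have h1 := hgF.2.1
      rw [Fin.prod_univ_succAbove _ i, map_mul, h, mul_zero] at h1
      exact zero_ne_one h1
    · intro B hB hBA
      have h1 := hgF.2.2 B hB.1 hBA
      rw [Fin.prod_univ_succAbove _ i, map_mul] at h1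
      refine (mul_eq_zero.1 h1).resolve_left fun h2 => hB.2 ?_
      rw [hi]
      exact h2

/-- Two maximal lines of a `GC` set meet at a node. -/
theorem IsGC.exists_mem_inter {n : ℕ} {X L M : Set Pt} (hX : IsGC n X) (hL : IsMaxLine n X L)
    (hM : IsMaxLine n X M) : ∃ P ∈ X, P ∈ L ∧ P ∈ M := by
  cases n with
  | zero =>
    have hX1 : X.ncard = 1 := hX.1.1
    obtain ⟨P, rfl⟩ := Set.ncard_eq_one.1 hX1
    have key : ∀ {L}, IsMaxLine 0 {P} L → P ∈ L := by
      intro L hL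
      obtain ⟨Q, rfl, hQ⟩ : ({P} ∩ L).Nonempty := Set.nonempty_of_ncard_ne_zero (by rw [hL.2]; simp)
      exact hQ
    exact ⟨P, rfl, key hL, key hM⟩
  | succ n =>
    by_contra! hc
    have h1 := (hX.diff_maxLine hM).ncard_inter_le hL.1
    have h2 : X \ M ∩ L = X ∩ L := by
      ext x
      exact ⟨fun hx => ⟨hx.1.1, hx.2⟩, fun hx => ⟨⟨hx.1, hc x hx.1 hx.2⟩, hx.2⟩⟩
    rw [h2, hL.2] at h1
    omega

theorem IsGC.ncard_inter_inter {n : ℕ} {X L M : Set Pt} (hX : IsGC n X) (hL : IsMaxLine n X L)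
    (hM : IsMaxLine n X M) (h : L ≠ M) : (X ∩ L ∩ M).ncard = 1 := by
  obtain ⟨P, hP, hPL, hPM⟩ := hX.exists_mem_inter hL hM
  refine Set.ncard_eq_one.2 ⟨P, Set.eq_singleton_iff_unique_mem.2 ⟨⟨⟨hP, hPL⟩, hPM⟩, ?_⟩⟩
  exact fun Q hQ => hL.1.inter_subsingleton hM.1 h ⟨hQ.1.2, hQ.2⟩ ⟨hPL, hPM⟩

theorem IsGC.maxLine_diff {n : ℕ} {X L M : Set Pt} (hX : IsGC (n + 1) X)
    (hL : IsMaxLine (n + 1) X L) (hM : IsMaxLine (n + 1) X M) (h : L ≠ M) :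
    IsMaxLine n (X \ M) L := by
  refine ⟨hL.1, ?_⟩
  have h1 := hX.ncard_inter_inter hL hM h
  have h2 := Set.ncard_inter_add_ncard_sdiff_eq_ncard (X ∩ L) M
    (hX.1.finite.subset Set.inter_subset_left)
  have h3 : X \ M ∩ L = (X ∩ L) \ M := by
    ext x
    simp only [Set.mem_inter_iff, Set.mem_sdiff]
    tauto
  rw [h1, hL.2] at h2
  rw [h3]
  omega

/-- No three maximal lines of a `GC` set of positive degree are concurrent. -/
theorem IsGC.not_concurrent {n : ℕ} {X L M K : Set Pt} (hX : IsGC (n + 1) X)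
    (hL : IsMaxLine (n + 1) X L) (hM : IsMaxLine (n + 1) X M) (hK : IsMaxLine (n + 1) X K)
    (hLM : L ≠ M) (hLK : L ≠ K) (hMK : M ≠ K) {P : Pt} (hPL : P ∈ L) (hPM : P ∈ M) : P ∉ K := by
  obtain ⟨Q, hQ, hQL, hQM⟩ := (hX.diff_maxLine hK).exists_mem_inter
    (hX.maxLine_diff hL hK hLK) (hX.maxLine_diff hM hK hMK)
  rw [hL.1.inter_subsingleton hM.1 hLM ⟨hPL, hPM⟩ ⟨hQL, hQM⟩]
  exact hQ.2

/-- A line that is maximal for `X \ M` and contains no node of `X` on `M`. -/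
def IsNewLine (n : ℕ) (X M L : Set Pt) : Prop :=
  IsMaxLine n (X \ M) L ∧ ∀ x ∈ X, x ∈ L → x ∉ M

theorem IsGC.isMaxLine_or_isNewLine {n : ℕ} {X L M : Set Pt} (hX : IsGC (n + 1) X)
    (hL : IsMaxLine n (X \ M) L) : IsMaxLine (n + 1) X L ∨ IsNewLine n X M L := by
  by_cases h : ∀ x ∈ X, x ∈ L → x ∉ M
  · exact Or.inr ⟨hL, h⟩
  · push Not at h
    obtain ⟨P, hP, hPL, hPM⟩ := h
    refine Or.inl ⟨hL.1, le_antisymm (hX.ncard_inter_le hL.1) ?_⟩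
    have h1 : (X \ M ∩ L).ncard < (X ∩ L).ncard :=
      Set.ncard_lt_ncard (Set.ssubset_iff_of_subset
        (Set.inter_subset_inter_left _ Set.sdiff_subset) |>.2 ⟨P, ⟨hP, hPL⟩, fun h => h.1.2 hPM⟩)
        (hX.1.finite.subset Set.inter_subset_left)
    rw [hL.2] at h1
    omega

theorem IsMaxLine.exists_mem {n : ℕ} {X L : Set Pt} (hL : IsMaxLine n X L) : ∃ P ∈ X, P ∈ L :=
  Set.nonempty_of_ncard_ne_zero (s := X ∩ L) (by rw [hL.2]; omega)

theorem IsMaxLine.ne_of_diff {n : ℕ} {X M L : Set Pt} (hL : IsMaxLine n (X \ M) L) : L ≠ M := by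
  rintro rfl
  obtain ⟨P, hP, hPL⟩ := hL.exists_mem
  exact hP.2 hPL

theorem IsMaxLine.not_dvd {n : ℕ} {X M L : Set Pt} (hM : IsMaxLine n X M)
    (hLM : ∀ x ∈ X, x ∈ L → x ∉ M) {A : Pt} (hA : A ∈ X) (hAM : A ∈ M) {p f : BPoly}
    (hp : IsFund n X A p) (hf : f.totalDegree = 1) (hL : L = {x | eval x f = 0}) : ¬ f ∣ p := by
  rintro ⟨q, rfl⟩
  obtain ⟨hdeg, h1, h0⟩ := hp
  obtain ⟨g, hg, hMg⟩ := hM.1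
  have hfq : f * q ≠ 0 := by
    intro h
    simp [h] at h1
  rw [totalDegree_mul_of_isDomain (left_ne_zero_of_mul hfq) (right_ne_zero_of_mul hfq), hf] at hdeg
  have hcard := Set.ncard_sdiff_singleton_of_mem (s := X ∩ M) ⟨hA, hAM⟩
  rw [hM.2] at hcard
  obtain ⟨r, rfl⟩ : g ∣ q := by
    refine dvd_of_vanishing (S := (X ∩ M) \ {A}) hg le_rfl (by omega) ?_ ?_
    · intro x hx
      have := hx.1.2
      rwa [hMg] at this
    · intro x hx
      have h2 := h0 x hx.1.1 hx.2
      rw [map_mul] at h2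
      refine (mul_eq_zero.1 h2).resolve_left fun h3 => hLM x hx.1.1 ?_ hx.1.2
      rw [hL]
      exact h3
  rw [hMg] at hAM
  simp [show eval A g = 0 from hAM] at h1

theorem prod_factors_bijective {k : ℕ} {f : Fin (k + 1) → BPoly} (hf : ∀ i, (f i).totalDegree = 1)
    {T L : Set Pt} (hL : IsLine L) (hTL : T ⊆ L) (hT : T.ncard = k + 1)
    (h0 : ∀ x ∈ T, eval x (∏ i, f i) = 0) (hne : ∀ i, L ≠ {x | eval x (f i) = 0}) :
    (∀ i, ∃ D ∈ T, eval D (f i) = 0) ∧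
      ∀ D ∈ T, ∀ i j, eval D (f i) = 0 → eval D (f j) = 0 → i = j := by
  have h' : ∀ x ∈ T, ∃ i, eval x (f i) = 0 := by
    intro x hx
    have := h0 x hx
    rw [map_prod, Finset.prod_eq_zero_iff] at this
    obtain ⟨i, -, hi⟩ := this
    exact ⟨i, hi⟩
  have huniq : ∀ x ∈ T, ∀ y ∈ T, ∀ i, eval x (f i) = 0 → eval y (f i) = 0 → x = y := by
    intro x hx y hy i hxi hyi
    by_contra hxy
    exact hne i (hL.eq_of_two_common ⟨_, hf i, rfl⟩ hxy (hTL hx) (hTL hy) hxi hyi)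
  choose! φ hφ using h'
  have hinj : Set.InjOn φ T := by
    intro x hx y hy hxy
    refine huniq x hx y hy (φ x) (hφ x hx) ?_
    rw [hxy]
    exact hφ y hy
  have himg : φ '' T = Set.univ := by
    refine Set.eq_of_subset_of_ncard_le (Set.subset_univ _) ?_
    rw [hinj.ncard_image, hT, Set.ncard_univ]
    simp
  have hsurj : ∀ i, ∃ D ∈ T, φ D = i := by
    intro i
    have : i ∈ φ '' T := himg ▸ Set.mem_univ i
    exact this
  have hz : ∀ i, ∃ D ∈ T, φ D = i ∧ eval D (f i) = 0 := by
    intro i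
    obtain ⟨D, hD, rfl⟩ := hsurj i
    exact ⟨D, hD, rfl, hφ D hD⟩
  refine ⟨fun i => ?_, fun D hD i j hi hj => ?_⟩
  · obtain ⟨D, hD, -, h⟩ := hz i
    exact ⟨D, hD, h⟩
  · obtain ⟨E, hE, hEi, hE0⟩ := hz i
    obtain ⟨F, hF, hFj, hF0⟩ := hz j
    rw [← hEi, ← hFj, huniq E hE D hD i hE0 hi, huniq F hF D hD j hF0 hj]

theorem IsGC.exists_split_factor {j : ℕ} {X M L₁ L₂ L₃ : Set Pt} (hX : IsGC (j + 2) X)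
    (hM : IsMaxLine (j + 2) X M) (h₁ : IsNewLine (j + 1) X M L₁) (h₂ : IsNewLine (j + 1) X M L₂)
    (h₃ : IsNewLine (j + 1) X M L₃) {P : Pt} (hP : P ∈ X \ M) (hPL : P ∈ L₁) {A : Pt}
    (hA : A ∈ X ∩ M) :
    ∃ g q : BPoly, g.totalDegree = 1 ∧ q.totalDegree ≤ j + 1 ∧ eval P g = 0 ∧ eval P q ≠ 0 ∧
      eval A g ≠ 0 ∧ eval A q ≠ 0 ∧ (∀ B ∈ X, B ≠ A → eval B g ≠ 0 → eval B q = 0) ∧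
      L₁ ≠ {x | eval x g = 0} ∧ L₂ ≠ {x | eval x g = 0} ∧
      ∃ D ∈ X \ M ∩ L₃, eval D g = 0 := by
  obtain ⟨f, hf, hfund⟩ := hX.exists_prod hA.1
  have hne : ∀ {L}, IsNewLine (j + 1) X M L → ∀ i, L ≠ {x | eval x (f i) = 0} := by
    intro L hL i hLi
    exact hM.not_dvd hL.2 hA.1 hA.2 hfund (hf i) hLi (Finset.dvd_prod_of_mem f (Finset.mem_univ i))
  have h0 : ∀ {L}, IsNewLine (j + 1) X M L → ∀ x ∈ X \ M ∩ L, eval x (∏ i, f i) = 0 := by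
    intro L _ x hx
    refine hfund.2.2 x hx.1.1 ?_
    rintro rfl
    exact hx.1.2 hA.2
  obtain ⟨-, hu⟩ := prod_factors_bijective hf h₁.1.1 Set.inter_subset_right h₁.1.2 (h0 h₁) (hne h₁)
  obtain ⟨hs, -⟩ := prod_factors_bijective hf h₃.1.1 Set.inter_subset_right h₃.1.2 (h0 h₃) (hne h₃)
  have hPf := h0 h₁ P ⟨hP, hPL⟩
  rw [map_prod, Finset.prod_eq_zero_iff] at hPf
  obtain ⟨i, -, hi⟩ := hPf
  have hsplit : ∀ x, eval x (∏ i, f i) = eval x (f i) * eval x (∏ l, f (i.succAbove l)) := by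
    intro x
    rw [Fin.prod_univ_succAbove _ i, map_mul]
  have hA1 : eval A (f i) * eval A (∏ l, f (i.succAbove l)) = 1 := by
    rw [← hsplit]
    exact hfund.2.1
  refine ⟨f i, ∏ l, f (i.succAbove l), hf i, ?_, hi, ?_, ?_, ?_, ?_, hne h₁ i, hne h₂ i, hs i⟩
  · simpa using totalDegree_prod_le_card Finset.univ (fun l => hf (i.succAbove l))
  · rw [map_prod, Finset.prod_ne_zero_iff]
    intro l _ hl
    exact Fin.succAbove_ne i l (hu P ⟨hP, hPL⟩ _ _ hl hi)
  · exact left_ne_zero_of_mul (hA1 ▸ one_ne_zero)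
  · exact right_ne_zero_of_mul (hA1 ▸ one_ne_zero)
  · intro B hB hBA hBg
    have := hfund.2.2 B hB hBA
    rw [hsplit] at this
    exact (mul_eq_zero.1 this).resolve_left hBg

theorem IsGC.not_three_newLines {j : ℕ} {X M L₁ L₂ L₃ : Set Pt} (hX : IsGC (j + 2) X)
    (hM : IsMaxLine (j + 2) X M) (h₁ : IsNewLine (j + 1) X M L₁) (h₂ : IsNewLine (j + 1) X M L₂)
    (h₃ : IsNewLine (j + 1) X M L₃) (h12 : L₁ ≠ L₂) (h13 : L₁ ≠ L₃) (h23 : L₂ ≠ L₃) : False := by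
  have hY := hX.diff_maxLine hM
  obtain ⟨P, hP, hP1, hP2⟩ := hY.exists_mem_inter h₁.1 h₂.1
  have hP3 : P ∉ L₃ := hY.not_concurrent h₁.1 h₂.1 h₃.1 h12 h13 h23 hP1 hP2
  have key := fun A (hA : A ∈ X ∩ M) => hX.exists_split_factor hM h₁ h₂ h₃ hP hP1 hA
  choose! g q hg hq hgP hqP hgA hqA hgq hg1 hg2 D hD hgD using key
  have hfinD : (X \ M ∩ L₃).Finite := hY.1.finite.subset Set.inter_subset_left
  have hlt : (X \ M ∩ L₃).ncard < (X ∩ M).ncard := by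
    rw [h₃.1.2, hM.2]
    omega
  obtain ⟨A, hA, B, hB, hAB, hDE⟩ :=
    Set.exists_ne_map_eq_of_ncard_lt_of_maps_to hlt hD hfinD
  have hPD : P ≠ D A := by
    rintro h
    exact hP3 (h ▸ (hD A hA).2)
  have hgg : ∀ {x}, eval x (g A) = 0 ↔ eval x (g B) = 0 := by
    intro x
    have hBD : eval (D A) (g B) = 0 := by
      rw [hDE]
      exact hgD B hB
    exact ⟨zero_of_zero_of_two_common (hg A hA) (hg B hB) hPD (hgP A hA) (hgD A hA) (hgP B hB) hBD,
      zero_of_zero_of_two_common (hg B hB) (hg A hA) hPD (hgP B hB) hBD (hgP A hA) (hgD A hA)⟩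
  set h : BPoly := C (eval P (q B)) * q A - C (eval P (q A)) * q B with hh
  have hhdeg : h.totalDegree ≤ j + 1 := by
    refine (totalDegree_sub _ _).trans (max_le ?_ ?_)
    · refine (totalDegree_mul _ _).trans ?_
      rw [totalDegree_C, zero_add]
      exact hq A hA
    · refine (totalDegree_mul _ _).trans ?_
      rw [totalDegree_C, zero_add]
      exact hq B hB
  have hvan : ∀ x ∈ X, x ≠ A → x ≠ B → eval x (g A) ≠ 0 → eval x h = 0 := by
    intro x hx hxA hxB hxg
    have h1 := hgq A hA x hx hxA hxg
    have h2 := hgq B hB x hx hxB (fun h => hxg (hgg.2 h))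
    simp [hh, h1, h2]
  have hPh : eval P h = 0 := by
    simp [hh]
    ring
  have hvanL : ∀ {L}, IsLine L → P ∈ L → L ≠ {x | eval x (g A) = 0} →
      ∀ x ∈ X \ M ∩ L, eval x h = 0 := by
    intro L hL hPL hLg x hx
    by_cases hxP : x = P
    · rw [hxP, hPh]
    · refine hvan x hx.1.1 ?_ ?_ ?_
      · rintro rfl
        exact hx.1.2 hA.2
      · rintro rfl
        exact hx.1.2 hB.2
      · intro hxg
        exact hLg (hL.eq_of_two_common ⟨_, hg A hA, rfl⟩ hxP hx.2 hPL hxg (hgP A hA))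
  have hAh : eval A h ≠ 0 := by
    have h1 : eval A (q B) = 0 := hgq B hB A hA.1 hAB (fun h => hgA A hA (hgg.2 h))
    simp [hh, h1, hqP B hB, hqA A hA]
  obtain ⟨f₁, hf₁, hL₁⟩ := h₁.1.1
  obtain ⟨f₂, hf₂, hL₂⟩ := h₂.1.1
  obtain ⟨m, hm, hMm⟩ := hM.1
  have hfL : ∀ {x}, x ∈ L₁ ↔ eval x f₁ = 0 := by rw [hL₁]; rfl
  have hfL' : ∀ {x}, x ∈ L₂ ↔ eval x f₂ = 0 := by rw [hL₂]; rfl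
  have hmM : ∀ {x}, x ∈ M ↔ eval x m = 0 := by rw [hMm]; rfl
  rcases eq_zero_or_exists_mul_of_vanishing (S := X \ M ∩ L₁) hf₁ hhdeg h₁.1.2.ge
    (fun x hx => hfL.1 hx.2) (hvanL h₁.1.1 hP1 (hg1 A hA)) with hz | ⟨u, hu, hudeg⟩
  · rw [hz, map_zero] at hAh
    exact hAh rfl
  have hcard₂ := Set.ncard_sdiff_singleton_of_mem (s := X \ M ∩ L₂) ⟨hP, hP2⟩
  rw [h₂.1.2] at hcard₂
  rcases eq_zero_or_exists_mul_of_vanishing (S := (X \ M ∩ L₂) \ {P}) (d := j) hf₂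
    (by omega : u.totalDegree ≤ j) (by omega) (fun x hx => hfL'.1 hx.1.2) (by
      intro x hx
      have h1 := hvanL h₂.1.1 hP2 (hg2 A hA) x hx.1
      rw [hu, map_mul] at h1
      refine (mul_eq_zero.1 h1).resolve_left fun h2 => hx.2 ?_
      exact h₁.1.1.inter_subsingleton h₂.1.1 h12 ⟨hfL.2 h2, hx.1.2⟩ ⟨hP1, hP2⟩) with
    hz | ⟨v, hv, hvdeg⟩
  · rw [hu, hz, mul_zero, map_zero] at hAh
    exact hAh rfl
  have hr : (X ∩ M ∩ {x | eval x (g A) = 0}).ncard ≤ 1 := by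
    have hsub : (X ∩ M ∩ {x | eval x (g A) = 0}).Subsingleton := by
      refine (hM.1.inter_subsingleton ⟨g A, hg A hA, rfl⟩ ?_).anti
        (Set.inter_subset_inter_left _ Set.inter_subset_right)
      intro h1
      have h2 := hA.2
      rw [h1] at h2
      exact hgA A hA h2
    exact (Set.ncard_le_one (hX.1.finite.subset
      (Set.inter_subset_left.trans Set.inter_subset_left))).2 fun _ ha _ hb => hsub ha hb
  have hfinM : (X ∩ M).Finite := hX.1.finite.subset Set.inter_subset_left
  have hcard : j ≤ (((X ∩ M) \ {x | eval x (g A) = 0}) \ {A, B}).ncard := by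
    have h1 := Set.ncard_inter_add_ncard_sdiff_eq_ncard (X ∩ M) {x | eval x (g A) = 0} hfinM
    have h2 := Set.ncard_le_ncard_sdiff_add_ncard ((X ∩ M) \ {x | eval x (g A) = 0}) {A, B}
    rw [Set.ncard_pair hAB] at h2
    rw [hM.2] at h1
    omega
  obtain ⟨w, hw⟩ : m ∣ v := by
    refine dvd_of_vanishing (S := ((X ∩ M) \ {x | eval x (g A) = 0}) \ {A, B}) hm le_rfl
      (by omega) (fun x hx => hmM.1 hx.1.1.2) ?_
    intro x hx
    have h1 := hvan x hx.1.1.1 (fun h => hx.2 (Or.inl h)) (fun h => hx.2 (Or.inr h)) hx.1.2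
    rw [hu, hv, map_mul, map_mul] at h1
    have hx1 : eval x f₁ ≠ 0 := fun h2 => h₁.2 x hx.1.1.1 (hfL.2 h2) hx.1.1.2
    have hx2 : eval x f₂ ≠ 0 := fun h2 => h₂.2 x hx.1.1.1 (hfL'.2 h2) hx.1.1.2
    exact (mul_eq_zero.1 ((mul_eq_zero.1 h1).resolve_left hx1)).resolve_left hx2
  apply hAh
  rw [hu, hv, hw]
  simp [hmM.1 hA.2]

theorem IsGC.newLine_unique_of_two {X M L L' K : Set Pt} (hX : IsGC 2 X)
    (hM : IsMaxLine 2 X M) (hL : IsNewLine 1 X M L) (hL' : IsNewLine 1 X M L')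
    (hK : IsMaxLine 2 X K) (hKM : K ≠ M) : L = L' := by
  by_contra hLL
  have hY := hX.diff_maxLine hM
  have hKY := hX.maxLine_diff hK hM hKM
  obtain ⟨A, hA, hAK, hAM⟩ := hX.exists_mem_inter hK hM
  have hKL : ∀ {L}, IsNewLine 1 X M L → K ≠ L := by
    rintro L hL rfl
    exact hL.2 A hA hAK hAM
  obtain ⟨P, hP, hPL, hPL'⟩ := hY.exists_mem_inter hL.1 hL'.1
  obtain ⟨D, hD, hDK, hDL⟩ := hY.exists_mem_inter hKY hL.1
  obtain ⟨E, hE, hEK, hEL⟩ := hY.exists_mem_inter hKY hL'.1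
  have hPK : P ∉ K := hY.not_concurrent hL.1 hL'.1 hKY hLL (hKL hL).symm (hKL hL').symm hPL hPL'
  have hPD : P ≠ D := by
    rintro rfl
    exact hPK hDK
  have hPE : P ≠ E := by
    rintro rfl
    exact hPK hEK
  have hDE : D ≠ E := by
    rintro rfl
    exact hPD (hL.1.1.inter_subsingleton hL'.1.1 hLL ⟨hPL, hPL'⟩ ⟨hDL, hEL⟩)
  obtain ⟨f, hf, hfund⟩ := hX.exists_prod hA
  have hdvd : ∀ i, f i ∣ ∏ i, f i := fun i => Finset.dvd_prod_of_mem f (Finset.mem_univ i)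
  have hzero : ∀ x ∈ X \ M, ∃ i, eval x (f i) = 0 := by
    intro x hx
    have h0 : eval x (∏ i, f i) = 0 := by
      refine hfund.2.2 x hx.1 ?_
      rintro rfl
      exact hx.2 hAM
    rw [map_prod, Finset.prod_eq_zero_iff] at h0
    obtain ⟨i, -, hi⟩ := h0
    exact ⟨i, hi⟩
  obtain ⟨i, hi⟩ := hzero D hD
  obtain ⟨i', hi'⟩ := hzero E hE
  obtain ⟨l, hl⟩ := hzero P hP
  have hii : i ≠ i' := by
    rintro rfl
    have hKi : K = {x | eval x (f i) = 0} :=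
      hK.1.eq_of_two_common ⟨_, hf i, rfl⟩ hDE hDK hEK hi hi'
    rw [hKi] at hAK
    have h1 := hfund.2.1
    obtain ⟨r, hr⟩ := hdvd i
    rw [hr, map_mul, show eval A (f i) = 0 from hAK, zero_mul] at h1
    exact zero_ne_one h1
  have hl' : l = i ∨ l = i' := by
    fin_cases i <;> fin_cases i' <;> fin_cases l <;> simp_all
  rcases hl' with rfl | rfl
  · exact hM.not_dvd hL.2 hA hAM hfund (hf l)
      (hL.1.1.eq_of_two_common ⟨_, hf l, rfl⟩ hPD hPL hDL hl hi) (hdvd l)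
  · exact hM.not_dvd hL'.2 hA hAM hfund (hf l)
      (hL'.1.1.eq_of_two_common ⟨_, hf l, rfl⟩ hPE hPL' hEL hl hi') (hdvd l)

theorem IsGC.newLine_unique_of_exists {j : ℕ} {X M L L' : Set Pt} (hX : IsGC (j + 2) X)
    (hM : IsMaxLine (j + 2) X M) (hL : IsNewLine (j + 1) X M L) (hL' : IsNewLine (j + 1) X M L')
    (h3 : ∃ K, IsMaxLine (j + 1) (X \ M) K ∧ K ≠ L ∧ K ≠ L')
    (hstep : ∀ K, IsMaxLine (j + 2) X K → K ≠ M → L = L') : L = L' := by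
  obtain ⟨K, hK, hKL, hKL'⟩ := h3
  rcases hX.isMaxLine_or_isNewLine hK with hK' | hK'
  · exact hstep K hK' hK.ne_of_diff
  · by_contra h
    exact hX.not_three_newLines hM hL hL' hK' h hKL.symm hKL'.symm

theorem IsGC.newLine_diff {j : ℕ} {X M L K : Set Pt} (hX : IsGC (j + 2) X)
    (hM : IsMaxLine (j + 2) X M) (hL : IsNewLine (j + 1) X M L) (hK : IsMaxLine (j + 2) X K)
    (hKM : K ≠ M) : IsNewLine j (X \ K) M L := by
  have hKL : L ≠ K := by
    rintro rfl
    obtain ⟨A, hA, hAK, hAM⟩ := hX.exists_mem_inter hK hM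
    exact hL.2 A hA hAK hAM
  refine ⟨?_, fun x hx => hL.2 x hx.1⟩
  rw [Set.sdiff_sdiff_comm]
  exact (hX.diff_maxLine hM).maxLine_diff hL.1 (hX.maxLine_diff hK hM hKM) hKL

theorem IsGC.exists_maxLine_of_one {X : Set Pt} (hX : IsGC 1 X) (a b : Set Pt) :
    ∃ M, IsMaxLine 1 X M ∧ M ≠ a ∧ M ≠ b := by
  have hcard : X.ncard = 3 := hX.1.1
  have key : ∀ A ∈ X, ∃ M, IsMaxLine 1 X M ∧ A ∉ M ∧ ∀ B ∈ X, B ≠ A → B ∈ M := by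
    intro A hA
    obtain ⟨f, hf, hfund⟩ := hX.exists_prod hA
    simp only [Fin.prod_univ_one] at hfund
    have hAM : A ∉ {x | eval x (f 0) = 0} := by
      intro h
      have h1 := hfund.2.1
      rw [show eval A (f 0) = 0 from h] at h1
      exact zero_ne_one h1
    refine ⟨{x | eval x (f 0) = 0}, ⟨⟨f 0, hf 0, rfl⟩, ?_⟩, hAM, hfund.2.2⟩
    have h1 := Set.ncard_sdiff_singleton_of_mem hA
    have h2 : X ∩ {x | eval x (f 0) = 0} = X \ {A} := by
      ext x
      refine ⟨fun hx => ⟨hx.1, ?_⟩, fun hx => ⟨hx.1, hfund.2.2 x hx.1 hx.2⟩⟩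
      rintro rfl
      exact hAM hx.2
    rw [h2, h1, hcard]
  choose! m hm hmA hmB using key
  obtain ⟨A, B, C, hAB, hAC, hBC, rfl⟩ := Set.ncard_eq_three.1 hcard
  have hne : ∀ x ∈ ({A, B, C} : Set Pt), ∀ y ∈ ({A, B, C} : Set Pt), x ≠ y → m x ≠ m y := by
    intro x hx y hy hxy h
    exact hmA x hx (h ▸ hmB y hy x hx hxy)
  have hA : A ∈ ({A, B, C} : Set Pt) := by simp
  have hB : B ∈ ({A, B, C} : Set Pt) := by simp
  have hC : C ∈ ({A, B, C} : Set Pt) := by simp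
  have h1 := hne A hA B hB hAB
  have h2 := hne A hA C hC hAC
  have h3 := hne B hB C hC hBC
  by_cases hAa : m A = a ∨ m A = b
  · by_cases hBa : m B = a ∨ m B = b
    · refine ⟨m C, hm C hC, ?_, ?_⟩ <;> grind
    · exact ⟨m B, hm B hB, by tauto, by tauto⟩
  · exact ⟨m A, hm A hA, by tauto, by tauto⟩

/-- The Gasca–Maeztu conjecture in all degrees from `1` to `n`. -/
def GMUpTo (n : ℕ) : Prop :=
  ∀ k : ℕ, 1 ≤ k → k ≤ n → ∀ Y : Set Pt, IsGC k Y → ∃ M : Set Pt, IsMaxLine k Y M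

theorem GMUpTo.exists_maxLine_and_newLine_unique {n : ℕ} (GM : GMUpTo n) :
    ∀ j, j + 1 ≤ n →
      (∀ X, IsGC (j + 1) X → ∀ a b, ∃ M, IsMaxLine (j + 1) X M ∧ M ≠ a ∧ M ≠ b) ∧
      ∀ X M L L', IsGC (j + 2) X → IsMaxLine (j + 2) X M → IsNewLine (j + 1) X M L →
        IsNewLine (j + 1) X M L' → L = L' := by
  intro j
  induction j with
  | zero =>
    intro _
    refine ⟨fun X hX a b => hX.exists_maxLine_of_one a b, fun X M L L' hX hM hL hL' => ?_⟩
    exact hX.newLine_unique_of_exists hM hL hL' ((hX.diff_maxLine hM).exists_maxLine_of_one L L')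
      fun K hK hKM => hX.newLine_unique_of_two hM hL hL' hK hKM
  | succ j ih =>
    intro hj
    obtain ⟨ih1, ih2⟩ := ih (by omega)
    have hex : ∀ X, IsGC (j + 1 + 1) X →
        ∀ a b, ∃ M, IsMaxLine (j + 1 + 1) X M ∧ M ≠ a ∧ M ≠ b := by
      intro X hX
      obtain ⟨K, hK⟩ := GM (j + 1 + 1) (by omega) hj X hX
      have hother : ∀ b, ∃ M, IsMaxLine (j + 1 + 1) X M ∧ M ≠ K ∧ M ≠ b := by
        intro b
        obtain ⟨L, hL, hLb, -⟩ := ih1 _ (hX.diff_maxLine hK) b b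
        obtain ⟨L', hL', hLb', hLL'⟩ := ih1 _ (hX.diff_maxLine hK) b L
        rcases hX.isMaxLine_or_isNewLine hL with h | h
        · exact ⟨L, h, hL.ne_of_diff, hLb⟩
        rcases hX.isMaxLine_or_isNewLine hL' with h' | h'
        · exact ⟨L', h', hL'.ne_of_diff, hLb'⟩
        exact absurd (ih2 X K L' L hX hK h' h) hLL'
      intro a b
      by_cases ha : K = a
      · obtain ⟨M, hM, hMK, hMb⟩ := hother b
        exact ⟨M, hM, ha ▸ hMK, hMb⟩
      by_cases hb : K = b
      · obtain ⟨M, hM, hMK, hMa⟩ := hother a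
        exact ⟨M, hM, hMa, hb ▸ hMK⟩
      exact ⟨K, hK, ha, hb⟩
    refine ⟨hex, fun X M L L' hX hM hL hL' => ?_⟩
    refine hX.newLine_unique_of_exists hM hL hL' (hex _ (hX.diff_maxLine hM) L L') ?_
    intro K hK hKM
    exact ih2 (X \ K) M L L' (hX.diff_maxLine hK) (hX.maxLine_diff hM hK hKM.symm)
      (hX.newLine_diff hM hL hK hKM) (hX.newLine_diff hM hL' hK hKM)

theorem GMUpTo.exists_maxLine {n j : ℕ} (GM : GMUpTo n) (hj : j + 1 ≤ n) {X : Set Pt}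
    (hX : IsGC (j + 1) X) (a b : Set Pt) : ∃ M, IsMaxLine (j + 1) X M ∧ M ≠ a ∧ M ≠ b :=
  (GM.exists_maxLine_and_newLine_unique j hj).1 X hX a b

theorem GMUpTo.newLine_unique {n j : ℕ} (GM : GMUpTo n) (hj : j + 1 ≤ n) {X M L L' : Set Pt}
    (hX : IsGC (j + 2) X) (hM : IsMaxLine (j + 2) X M) (hL : IsNewLine (j + 1) X M L)
    (hL' : IsNewLine (j + 1) X M L') : L = L' :=
  (GM.exists_maxLine_and_newLine_unique j hj).2 X M L L' hX hM hL hL'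

theorem IsGC.eq_of_mem_of_zero {X : Set Pt} (hX : IsGC 0 X) {x y : Pt} (hx : x ∈ X)
    (hy : y ∈ X) : x = y :=
  (Set.ncard_le_one hX.1.finite).1 (le_of_eq hX.1.1) x hx y hy

theorem IsGC.isMaxLine_of_subset {n : ℕ} {X L S : Set Pt} (hX : IsGC n X) (hL : IsLine L)
    (hS : S ⊆ X ∩ L) (h : n + 1 ≤ S.ncard) : IsMaxLine n X L :=
  ⟨hL, le_antisymm (hX.ncard_inter_le hL)
    (h.trans (Set.ncard_le_ncard hS (hX.1.finite.subset Set.inter_subset_left)))⟩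

theorem IsGC.not_four_maxLines {X L₁ L₂ L₃ L₄ : Set Pt} (hX : IsGC 1 X)
    (h₁ : IsMaxLine 1 X L₁) (h₂ : IsMaxLine 1 X L₂) (h₃ : IsMaxLine 1 X L₃)
    (h₄ : IsMaxLine 1 X L₄) (h12 : L₁ ≠ L₂) (h13 : L₁ ≠ L₃) (h14 : L₁ ≠ L₄) (h23 : L₂ ≠ L₃)
    (h24 : L₂ ≠ L₄) (h34 : L₃ ≠ L₄) : False := by
  have hY := hX.diff_maxLine h₁
  obtain ⟨P, hP, hP2, hP3⟩ := hY.exists_mem_inter (hX.maxLine_diff h₂ h₁ h12.symm)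
    (hX.maxLine_diff h₃ h₁ h13.symm)
  obtain ⟨Q, hQ, hQ4⟩ := (hX.maxLine_diff h₄ h₁ h14.symm).exists_mem
  obtain rfl := hY.eq_of_mem_of_zero hP hQ
  exact hX.not_concurrent h₂ h₃ h₄ h23 h24 h34 hP2 hP3 hQ4

theorem IsNodeLine.ne_maxLine {n : ℕ} {X L M : Set Pt} (hL : IsNodeLine n X L)
    (hM : IsMaxLine n X M) : L ≠ M := by
  rintro rfl
  have h1 := hM.2
  rw [hL.2] at h1
  omega

theorem IsNodeLine.diff {k : ℕ} {X L M : Set Pt} (hL : IsNodeLine (k + 1) X L) (hM : IsLine M)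
    (hLM : L ≠ M) {P : Pt} (hP : P ∈ X) (hPL : P ∈ L) (hPM : P ∈ M) : IsNodeLine k (X \ M) L := by
  refine ⟨hL.1, ?_⟩
  have h1 := Set.ncard_sdiff_singleton_of_mem (s := X ∩ L) ⟨hP, hPL⟩
  have h2 : X \ M ∩ L = (X ∩ L) \ {P} := by
    ext x
    constructor
    · rintro ⟨⟨hx, hxM⟩, hxL⟩
      refine ⟨⟨hx, hxL⟩, ?_⟩
      rintro rfl
      exact hxM hPM
    · rintro ⟨⟨hx, hxL⟩, hxP⟩
      exact ⟨⟨hx, fun hxM => hxP (hL.1.inter_subsingleton hM hLM ⟨hxL, hxM⟩ ⟨hPL, hPM⟩)⟩, hxL⟩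
  rw [h2, h1, hL.2, Nat.add_sub_cancel]

/-- `X` is a `GC_n` set whose maximal lines are exactly the three distinct lines `a`, `b`, `c`. -/
structure HasThreeMaxLines (n : ℕ) (X a b c : Set Pt) : Prop where
  isGC : IsGC n X
  left : IsMaxLine n X a
  mid : IsMaxLine n X b
  right : IsMaxLine n X c
  left_ne_mid : a ≠ b
  left_ne_right : a ≠ c
  mid_ne_right : b ≠ c
  eq_or_eq_or_eq : ∀ M, IsMaxLine n X M → M = a ∨ M = b ∨ M = c

namespace HasThreeMaxLines

variable {n j : ℕ} {X a b c : Set Pt}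

theorem swap (T : HasThreeMaxLines n X a b c) : HasThreeMaxLines n X b a c :=
  ⟨T.isGC, T.mid, T.left, T.right, T.left_ne_mid.symm, T.mid_ne_right, T.left_ne_right,
    fun M hM => by have := T.eq_or_eq_or_eq M hM; tauto⟩

theorem rotate (T : HasThreeMaxLines n X a b c) : HasThreeMaxLines n X b c a :=
  ⟨T.isGC, T.mid, T.right, T.left, T.mid_ne_right, T.left_ne_mid.symm, T.left_ne_right.symm,
    fun M hM => by have := T.eq_or_eq_or_eq M hM; tauto⟩

theorem newLine_ne_mid (T : HasThreeMaxLines n X a b c) {m : ℕ} {L : Set Pt}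
    (hL : IsNewLine m X a L) : L ≠ b := by
  rintro rfl
  obtain ⟨A, hA, hAa, hAL⟩ := T.isGC.exists_mem_inter T.left T.mid
  exact hL.2 A hA hAL hAa

theorem newLine_ne_newLine (T : HasThreeMaxLines (j + 1) X a b c) {L L' : Set Pt}
    (hL : IsNewLine j X a L) (hL' : IsNewLine j X b L') : L ≠ L' := by
  rintro rfl
  obtain ⟨P, hP, hPL, hPb⟩ := (T.isGC.diff_maxLine T.left).exists_mem_inter hL.1
    (T.isGC.maxLine_diff T.mid T.left T.left_ne_mid.symm)
  exact hL'.2 P hP.1 hPL hPb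

theorem exists_newLine (T : HasThreeMaxLines (j + 2) X a b c) {N : ℕ} (GM : GMUpTo N)
    (hj : j + 1 ≤ N) : ∃ L, IsNewLine (j + 1) X a L := by
  obtain ⟨L, hL, hLb, hLc⟩ := GM.exists_maxLine hj (T.isGC.diff_maxLine T.left) b c
  refine ⟨L, (T.isGC.isMaxLine_or_isNewLine hL).resolve_left fun h => ?_⟩
  rcases T.eq_or_eq_or_eq L h with h | h | h
  exacts [hL.ne_of_diff h, hLb h, hLc h]

theorem diff (T : HasThreeMaxLines (j + 2) X a b c) {N : ℕ} (GM : GMUpTo N)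
    (hj : j + 1 ≤ N) {L : Set Pt} (hL : IsNewLine (j + 1) X a L) :
    HasThreeMaxLines (j + 1) (X \ a) b c L := by
  refine ⟨T.isGC.diff_maxLine T.left, T.isGC.maxLine_diff T.mid T.left T.left_ne_mid.symm,
    T.isGC.maxLine_diff T.right T.left T.left_ne_right.symm, hL.1, T.mid_ne_right,
    (T.newLine_ne_mid hL).symm, (T.rotate.rotate.swap.newLine_ne_mid hL).symm, fun M hM => ?_⟩
  rcases T.isGC.isMaxLine_or_isNewLine hM with h | h
  · rcases T.eq_or_eq_or_eq M h with h | h | h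
    · exact absurd h hM.ne_of_diff
    · exact Or.inl h
    · exact Or.inr (Or.inl h)
  · exact Or.inr (Or.inr (GM.newLine_unique hj T.isGC T.left h hL))

theorem newLine_diff_mid (T : HasThreeMaxLines (j + 2) X a b c) {L : Set Pt}
    (hL : IsNewLine (j + 1) X a L) : IsMaxLine j ((X \ a) \ b) L :=
  (T.isGC.diff_maxLine T.left).maxLine_diff hL.1
    (T.isGC.maxLine_diff T.mid T.left T.left_ne_mid.symm) (T.newLine_ne_mid hL)

theorem isGC_diff_diff (T : HasThreeMaxLines (j + 2) X a b c) : IsGC j ((X \ a) \ b) :=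
  (T.isGC.diff_maxLine T.left).diff_maxLine
    (T.isGC.maxLine_diff T.mid T.left T.left_ne_mid.symm)

theorem right_diff_diff (T : HasThreeMaxLines (j + 2) X a b c) : IsMaxLine j ((X \ a) \ b) c :=
  (T.isGC.diff_maxLine T.left).maxLine_diff
    (T.isGC.maxLine_diff T.right T.left T.left_ne_right.symm)
    (T.isGC.maxLine_diff T.mid T.left T.left_ne_mid.symm) T.mid_ne_right.symm

theorem isGC_diff_diff_diff (T : HasThreeMaxLines (j + 3) X a b c) : IsGC j (((X \ a) \ b) \ c) :=
  T.isGC_diff_diff.diff_maxLine T.right_diff_diff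

theorem newLine_diff_diff (T : HasThreeMaxLines (j + 3) X a b c) {L : Set Pt}
    (hL : IsNewLine (j + 2) X a L) : IsMaxLine j (((X \ a) \ b) \ c) L :=
  T.isGC_diff_diff.maxLine_diff (T.newLine_diff_mid hL) T.right_diff_diff
    (T.rotate.rotate.swap.newLine_ne_mid hL)

theorem newLine_diff_diff_mid (T : HasThreeMaxLines (j + 3) X a b c) {L : Set Pt}
    (hL : IsNewLine (j + 2) X b L) : IsMaxLine j (((X \ a) \ b) \ c) L := by
  rw [Set.sdiff_sdiff_comm (s := X)]
  exact T.swap.newLine_diff_diff hL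

theorem newLine_diff_diff_right (T : HasThreeMaxLines (j + 3) X a b c) {L : Set Pt}
    (hL : IsNewLine (j + 2) X c L) : IsMaxLine j (((X \ a) \ b) \ c) L := by
  have h := T.rotate.rotate.newLine_diff_diff hL
  rwa [Set.sdiff_sdiff_comm (s := X), Set.sdiff_sdiff_comm (s := X \ a)] at h

theorem not_mem_right (T : HasThreeMaxLines (j + 1) X a b c) {P : Pt} (ha : P ∈ a)
    (hb : P ∈ b) : P ∉ c :=
  T.isGC.not_concurrent T.left T.mid T.right T.left_ne_mid T.left_ne_right T.mid_ne_right ha hb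

theorem vertex_isMaxLine (T : HasThreeMaxLines (j + 3) X a b c) {L : Set Pt}
    (hL : IsNodeLine (j + 3) X L) {v w : Pt} (hv : v ∈ L) (hva : v ∈ a) (hvb : v ∈ b)
    (hw : w ∈ L) (hwc : w ∈ c) : IsMaxLine j (((X \ a) \ b) \ c) L := by
  refine T.isGC_diff_diff_diff.isMaxLine_of_subset (S := (X ∩ L) \ {v, w}) hL.1 ?_ ?_
  · rintro x ⟨⟨hx, hxL⟩, hxvw⟩
    refine ⟨⟨⟨⟨hx, fun h => hxvw (Or.inl ?_)⟩, fun h => hxvw (Or.inl ?_)⟩,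
      fun h => hxvw (Or.inr ?_)⟩, hxL⟩
    · exact hL.1.inter_subsingleton T.left.1 (hL.ne_maxLine T.left) ⟨hxL, h⟩ ⟨hv, hva⟩
    · exact hL.1.inter_subsingleton T.mid.1 (hL.ne_maxLine T.mid) ⟨hxL, h⟩ ⟨hv, hvb⟩
    · exact hL.1.inter_subsingleton T.right.1 (hL.ne_maxLine T.right) ⟨hxL, h⟩ ⟨hw, hwc⟩
  · have h1 := Set.ncard_le_ncard_sdiff_add_ncard (X ∩ L) {v, w}
    have h2 : ({v, w} : Set Pt).ncard ≤ 2 := Set.ncard_insert_le v {w} |>.trans (by simp)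
    rw [hL.2] at h1
    omega

theorem vertex_base (T : HasThreeMaxLines 4 X a b c) {N : ℕ} (GM : GMUpTo N) (hN : 4 ≤ N)
    {L : Set Pt} (hL : IsNodeLine 4 X L) {v w : Pt} (hv : v ∈ X) (hvL : v ∈ L) (hva : v ∈ a)
    (hvb : v ∈ b) (hw : w ∈ X) (hwL : w ∈ L) (hwc : w ∈ c) : False := by
  obtain ⟨la, hla⟩ := T.exists_newLine GM (by omega)
  obtain ⟨lb, hlb⟩ := T.rotate.exists_newLine GM (by omega)
  obtain ⟨lc, hlc⟩ := T.rotate.rotate.exists_newLine GM (by omega)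
  refine T.isGC_diff_diff_diff.not_four_maxLines (T.newLine_diff_diff hla)
    (T.newLine_diff_diff_mid hlb) (T.newLine_diff_diff_right hlc)
    (T.vertex_isMaxLine hL hvL hva hvb hwL hwc) (T.newLine_ne_newLine hla hlb)
    (T.rotate.rotate.newLine_ne_newLine hlc hla).symm ?_ (T.rotate.newLine_ne_newLine hlb hlc) ?_ ?_
  · rintro rfl
    exact hla.2 v hv hvL hva
  · rintro rfl
    exact hlb.2 v hv hvL hvb
  · rintro rfl
    exact hlc.2 w hw hwL hwc

theorem corner_unique (T : HasThreeMaxLines 4 X a b c) {lb lc : Set Pt} (hlb : IsNewLine 3 X b lb)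
    (hlc : IsNewLine 3 X c lc) {P Q : Pt} (hP : P ∈ (((X \ b) \ c) \ lb) \ lc)
    (hQ : Q ∈ (((X \ b) \ c) \ lb) \ lc) : P = Q := by
  have h1 := T.rotate.newLine_diff_mid hlb
  have h2 := T.rotate.swap.newLine_diff_mid hlc
  rw [Set.sdiff_sdiff_comm] at h2
  have h3 := T.rotate.isGC_diff_diff
  have h4 := (h3.diff_maxLine h1).diff_maxLine
    (h3.maxLine_diff h2 h1 (T.rotate.newLine_ne_newLine hlb hlc).symm)
  exact h4.eq_of_mem_of_zero hP hQ

theorem exists_line_through_corners (T : HasThreeMaxLines 4 X a b c) {N : ℕ} (GM : GMUpTo N)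
    (hN : 4 ≤ N) {la lb lc : Set Pt} (hla : IsNewLine 3 X a la) (hlb : IsNewLine 3 X b lb)
    (hlc : IsNewLine 3 X c lc) {A B : Pt} (hA : A ∈ (((X \ b) \ c) \ lb) \ lc)
    (hB : B ∈ (((X \ a) \ c) \ la) \ lc) :
    ∃ μ, IsLine μ ∧ A ∈ μ ∧ B ∈ μ ∧ ∃ O ∈ μ, O ∈ la ∧ O ∈ lb := by
  have Tc := T.rotate.rotate.diff GM (by omega) hlc
  have T' := Tc.rotate.rotate
  have hG : IsGC 2 ((X \ c) \ lc) := T'.isGC.diff_maxLine T'.left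
  have ha : IsMaxLine 2 ((X \ c) \ lc) a :=
    T'.isGC.maxLine_diff T'.mid T'.left T'.left_ne_mid.symm
  have hb : IsMaxLine 2 ((X \ c) \ lc) b :=
    T'.isGC.maxLine_diff T'.right T'.left T'.left_ne_right.symm
  obtain ⟨μ, hμ, hμa, hμb⟩ := GM.exists_maxLine (by omega) hG a b
  have hba := hG.maxLine_diff hb ha T.left_ne_mid.symm
  have hGa := hG.diff_maxLine ha
  obtain ⟨O, hO, hOμ⟩ := (hGa.maxLine_diff (hG.maxLine_diff hμ ha hμa) hba hμb).exists_mem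
  have hZ : (((X \ c) \ lc) \ a) \ b = (((X \ a) \ b) \ c) \ lc := by
    ext x
    simp only [Set.mem_sdiff]
    tauto
  have hG0 := hGa.diff_maxLine hba
  have hOl : ∀ {l}, IsMaxLine 1 (((X \ a) \ b) \ c) l → l ≠ lc → O ∈ l := by
    intro l hl hne
    obtain ⟨O', hO', hO'l⟩ :=
      (T.isGC_diff_diff_diff.maxLine_diff hl (T.newLine_diff_diff_right hlc) hne).exists_mem
    rw [← hZ] at hO'
    rwa [hG0.eq_of_mem_of_zero hO hO']
  have hOa : O ∈ la := hOl (T.newLine_diff_diff hla) (T.rotate.rotate.newLine_ne_newLine hlc hla).symm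
  have hOb : O ∈ lb := hOl (T.newLine_diff_diff_mid hlb) (T.rotate.newLine_ne_newLine hlb hlc)
  obtain ⟨A', hA', hA'μ, hA'a⟩ := hG.exists_mem_inter hμ ha
  obtain ⟨B', hB', hB'μ, hB'b⟩ := hG.exists_mem_inter hμ hb
  have hA'b : A' ∉ b := hG.not_concurrent hμ ha hb hμa hμb T.left_ne_mid hA'μ hA'a
  have hB'a : B' ∉ a := hG.not_concurrent hμ hb ha hμb hμa T.left_ne_mid.symm hB'μ hB'b
  have hA'lb : A' ∉ lb := by
    intro h
    have hne : A' ≠ O := by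
      rintro rfl
      exact hO.1.2 hA'a
    obtain rfl := hμ.1.eq_of_two_common hlb.1.1 hne hA'μ hOμ h hOb
    exact hlb.2 B' hB'.1.1 hB'μ hB'b
  have hB'la : B' ∉ la := by
    intro h
    have hne : B' ≠ O := by
      rintro rfl
      exact hO.2 hB'b
    obtain rfl := hμ.1.eq_of_two_common hla.1.1 hne hB'μ hOμ h hOa
    exact hla.2 A' hA'.1.1 hA'μ hA'a
  have hAA' : A = A' :=
    T.corner_unique hlb hlc hA ⟨⟨⟨⟨hA'.1.1, hA'b⟩, hA'.1.2⟩, hA'lb⟩, hA'.2⟩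
  have hBB' : B = B' :=
    T.swap.corner_unique hla hlc hB ⟨⟨⟨⟨hB'.1.1, hB'a⟩, hB'.1.2⟩, hB'la⟩, hB'.2⟩
  exact ⟨μ, hμ.1, hAA' ▸ hA'μ, hBB' ▸ hB'μ, O, hOμ, hOa, hOb⟩

theorem transversal_base_of_not_mem (T : HasThreeMaxLines 4 X a b c) {N : ℕ} (GM : GMUpTo N)
    (hN : 4 ≤ N) {la lb lc : Set Pt} (hla : IsNewLine 3 X a la) (hlb : IsNewLine 3 X b lb)
    (hlc : IsNewLine 3 X c lc) {L : Set Pt} (hL : IsLine L) {A B C O : Pt} (hA : A ∈ (X \ b) \ c)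
    (hAL : A ∈ L) (hAa : A ∈ a) (hB : B ∈ (X \ a) \ c) (hBL : B ∈ L) (hBb : B ∈ b)
    (hC : C ∈ (X \ a) \ b) (hCL : C ∈ L) (hCc : C ∈ c) (hO : O ∈ ((X \ a) \ b) \ c) (hOL : O ∈ L)
    (hOa : O ∉ la) : False := by
  have hZ := T.isGC_diff_diff_diff
  have hlaZ := T.newLine_diff_diff hla
  have hab := T.newLine_ne_newLine hla hlb
  have hca := T.rotate.rotate.newLine_ne_newLine hlc hla
  have hOl : ∀ {l}, IsMaxLine 1 (((X \ a) \ b) \ c) l → l ≠ la → O ∈ l := by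
    intro l hl hne
    obtain ⟨O', hO', hO'l⟩ := (hZ.maxLine_diff hl hlaZ hne).exists_mem
    rwa [(hZ.diff_maxLine hlaZ).eq_of_mem_of_zero ⟨hO, hOa⟩ hO']
  have hOb : O ∈ lb := hOl (T.newLine_diff_diff_mid hlb) hab.symm
  have hOc : O ∈ lc := hOl (T.newLine_diff_diff_right hlc) hca
  have hLb : L ≠ lb := by
    rintro rfl
    exact hlb.2 B hB.1.1 hBL hBb
  have hLc : L ≠ lc := by
    rintro rfl
    exact hlc.2 C hC.1.1 hCL hCc
  have hlb' : ∀ P ∈ L, P ∈ lb → P = O := fun P hP hPl =>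
    hL.inter_subsingleton hlb.1.1 hLb ⟨hP, hPl⟩ ⟨hOL, hOb⟩
  have hlc' : ∀ P ∈ L, P ∈ lc → P = O := fun P hP hPl =>
    hL.inter_subsingleton hlc.1.1 hLc ⟨hP, hPl⟩ ⟨hOL, hOc⟩
  have hAO : A ≠ O := by
    rintro rfl
    exact hO.1.1.2 hAa
  have hBO : B ≠ O := by
    rintro rfl
    exact hO.1.2 hBb
  have hCO : C ≠ O := by
    rintro rfl
    exact hO.2 hCc
  have hAlb : A ∉ lb := fun h => hAO (hlb' A hAL h)
  have hAlc : A ∉ lc := fun h => hAO (hlc' A hAL h)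
  have hBla : B ∈ la := by
    by_contra h
    obtain ⟨μ, hμ, hAμ, hBμ, O', hO'μ, hO'a, hO'b⟩ := T.exists_line_through_corners GM hN hla hlb
      hlc (A := A) (B := B) ⟨⟨hA, hAlb⟩, hAlc⟩ ⟨⟨hB, h⟩, fun h => hBO (hlc' B hBL h)⟩
    have hAB : A ≠ B := by
      rintro rfl
      exact hA.1.2 hBb
    obtain rfl := hL.eq_of_two_common hμ hAB hAL hBL hAμ hBμ
    exact hOa (hlb' O' hO'μ hO'b ▸ hO'a)
  have hCla : C ∈ la := by
    by_contra h
    obtain ⟨μ, hμ, hAμ, hCμ, O', hO'μ, hO'a, hO'c⟩ :=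
      T.rotate.rotate.swap.exists_line_through_corners GM hN hla hlc
      hlb (A := A) (B := C) ⟨⟨⟨⟨hA.1.1, hA.2⟩, hA.1.2⟩, hAlc⟩, hAlb⟩
      ⟨⟨hC, h⟩, fun h => hCO (hlb' C hCL h)⟩
    have hAC : A ≠ C := by
      rintro rfl
      exact hA.2 hCc
    obtain rfl := hL.eq_of_two_common hμ hAC hAL hCL hAμ hCμ
    exact hOa (hlc' O' hO'μ hO'c ▸ hO'a)
  have hBC : B ≠ C := by
    rintro rfl
    exact hB.2 hCc
  obtain rfl := hL.eq_of_two_common hla.1.1 hBC hBL hCL hBla hCla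
  exact hla.2 A hA.1.1 hAL hAa

theorem transversal_base (T : HasThreeMaxLines 4 X a b c) {N : ℕ} (GM : GMUpTo N)
    (hN : 4 ≤ N) {L : Set Pt} (hL : IsNodeLine 4 X L) {A B C : Pt} (hA : A ∈ (X \ b) \ c)
    (hAL : A ∈ L) (hAa : A ∈ a) (hB : B ∈ (X \ a) \ c) (hBL : B ∈ L) (hBb : B ∈ b)
    (hC : C ∈ (X \ a) \ b) (hCL : C ∈ L) (hCc : C ∈ c) : False := by
  obtain ⟨la, hla⟩ := T.exists_newLine GM (by omega)
  obtain ⟨lb, hlb⟩ := T.rotate.exists_newLine GM (by omega)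
  obtain ⟨lc, hlc⟩ := T.rotate.rotate.exists_newLine GM (by omega)
  obtain ⟨O, ⟨hO, hOL⟩, hO'⟩ : ((X ∩ L) \ {A, B, C}).Nonempty := by
    apply Set.nonempty_of_ncard_ne_zero
    have h1 := Set.ncard_le_ncard_sdiff_add_ncard (X ∩ L) {A, B, C}
    have h2 : ({A, B, C} : Set Pt).ncard ≤ 3 :=
      (Set.ncard_insert_le A {B, C}).trans (Nat.succ_le_succ
        ((Set.ncard_insert_le B {C}).trans (by simp)))
    rw [hL.2] at h1
    omega
  have hOa : O ∉ a := fun h => hO' (Or.inl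
    (hL.1.inter_subsingleton T.left.1 (hL.ne_maxLine T.left) ⟨hOL, h⟩ ⟨hAL, hAa⟩))
  have hOb : O ∉ b := fun h => hO' (Or.inr (Or.inl
    (hL.1.inter_subsingleton T.mid.1 (hL.ne_maxLine T.mid) ⟨hOL, h⟩ ⟨hBL, hBb⟩)))
  have hOc : O ∉ c := fun h => hO' (Or.inr (Or.inr
    (hL.1.inter_subsingleton T.right.1 (hL.ne_maxLine T.right) ⟨hOL, h⟩ ⟨hCL, hCc⟩)))
  by_cases h1 : O ∈ la
  · by_cases h2 : O ∈ lb
    · have h3 : O ∉ lc := T.isGC_diff_diff_diff.not_concurrent (T.newLine_diff_diff hla)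
        (T.newLine_diff_diff_mid hlb) (T.newLine_diff_diff_right hlc)
        (T.newLine_ne_newLine hla hlb) (T.rotate.rotate.newLine_ne_newLine hlc hla).symm
        (T.rotate.newLine_ne_newLine hlb hlc) h1 h2
      exact T.rotate.rotate.transversal_base_of_not_mem GM hN hlc hla hlb hL.1 hC hCL hCc
        ⟨⟨hA.1.1, hA.2⟩, hA.1.2⟩ hAL hAa ⟨⟨hB.1.1, hB.2⟩, hB.1.2⟩ hBL hBb
        ⟨⟨⟨hO, hOc⟩, hOa⟩, hOb⟩ hOL h3
    · exact T.swap.transversal_base_of_not_mem GM hN hlb hla hlc hL.1 hB hBL hBb hA hAL hAa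
        ⟨⟨hC.1.1, hC.2⟩, hC.1.2⟩ hCL hCc ⟨⟨⟨hO, hOb⟩, hOa⟩, hOc⟩ hOL h2
  · exact T.transversal_base_of_not_mem GM hN hla hlb hlc hL.1 hA hAL hAa hB hBL hBb hC hCL hCc
      ⟨⟨⟨hO, hOa⟩, hOb⟩, hOc⟩ hOL h1

end HasThreeMaxLines

/-- Every `n`-node line of a `GC_n` set with exactly three maximal lines misses the nodes
of one of them. -/
def NodeLinesMiss (n : ℕ) : Prop :=
  ∀ X a b c L, HasThreeMaxLines n X a b c → IsNodeLine n X L →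
    (∀ x ∈ X, x ∈ L → x ∉ a) ∨ (∀ x ∈ X, x ∈ L → x ∉ b) ∨ ∀ x ∈ X, x ∈ L → x ∉ c

namespace HasThreeMaxLines

variable {j : ℕ} {X a b c : Set Pt}

theorem vertex_step (T : HasThreeMaxLines (j + 5) X a b c) {N : ℕ} (GM : GMUpTo N)
    (hN : j + 5 ≤ N) (ih : NodeLinesMiss (j + 4)) {L : Set Pt} (hL : IsNodeLine (j + 5) X L)
    {v w : Pt} (hv : v ∈ X) (hvL : v ∈ L) (hva : v ∈ a) (hvb : v ∈ b) (hw : w ∈ X) (hwL : w ∈ L)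
    (hwc : w ∈ c) : False := by
  obtain ⟨lc, hlc⟩ := T.rotate.rotate.exists_newLine GM (by omega)
  have hvc : v ∉ c := T.not_mem_right hva hvb
  have Tc := T.rotate.rotate.diff GM (by omega) hlc
  have hLc := hL.diff T.right.1 (hL.ne_maxLine T.right) hw hwL hwc
  rcases ih _ _ _ _ _ Tc hLc with h | h | h
  · exact h v ⟨hv, hvc⟩ hvL hva
  · exact h v ⟨hv, hvc⟩ hvL hvb
  · obtain ⟨P, hP, hPL, hPl⟩ := T.isGC_diff_diff_diff.exists_mem_inter
      (T.vertex_isMaxLine hL hvL hva hvb hwL hwc) (T.newLine_diff_diff_right hlc)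
    exact h P ⟨hP.1.1.1, hP.2⟩ hPL hPl

theorem transversal_step (T : HasThreeMaxLines (j + 5) X a b c) {N : ℕ} (GM : GMUpTo N)
    (hN : j + 5 ≤ N) (ih : NodeLinesMiss (j + 4)) {L : Set Pt} (hL : IsNodeLine (j + 5) X L)
    {A B C : Pt} (hA : A ∈ (X \ b) \ c) (hAL : A ∈ L) (hAa : A ∈ a) (hB : B ∈ (X \ a) \ c)
    (hBL : B ∈ L) (hBb : B ∈ b) (hC : C ∈ (X \ a) \ b) (hCL : C ∈ L) (hCc : C ∈ c) : False := by
  have key : ∀ {a b c : Set Pt}, HasThreeMaxLines (j + 5) X a b c → ∀ {A B C : Pt},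
      A ∈ X → A ∈ L → A ∈ a → B ∈ X \ a → B ∈ L → B ∈ b → C ∈ X \ a → C ∈ L → C ∈ c →
      ∃ l, IsNewLine (j + 4) X a l ∧ ∀ x ∈ X \ a, x ∈ L → x ∉ l := by
    intro a b c T A B C hA hAL hAa hB hBL hBb hC hCL hCc
    obtain ⟨l, hl⟩ := T.exists_newLine GM (by omega)
    refine ⟨l, hl, ?_⟩
    have hLa := hL.diff T.left.1 (hL.ne_maxLine T.left) hA hAL hAa
    rcases ih _ _ _ _ _ (T.diff GM (by omega) hl) hLa with h | h | h
    · exact absurd hBb (h B hB hBL)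
    · exact absurd hCc (h C hC hCL)
    · exact h
  obtain ⟨la, hla, hLa⟩ := key T hA.1.1 hAL hAa hB.1 hBL hBb hC.1 hCL hCc
  obtain ⟨lb, hlb, hLb⟩ := key T.swap hB.1.1 hBL hBb hA.1 hAL hAa ⟨hC.1.1, hC.2⟩ hCL hCc
  have hG := T.isGC_diff_diff
  have hla' := T.newLine_diff_mid hla
  have hlb' := T.swap.newLine_diff_mid hlb
  rw [Set.sdiff_sdiff_comm] at hlb'
  have hL1 := hL.diff T.left.1 (hL.ne_maxLine T.left) hA.1.1 hAL hAa
  have hL2 := hL1.diff T.mid.1 (hL.ne_maxLine T.mid) hB.1 hBL hBb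
  have hL3 : IsMaxLine (j + 2) (((X \ a) \ b) \ la) L := by
    refine (hG.diff_maxLine hla').isMaxLine_of_subset (S := (X \ a) \ b ∩ L) hL.1 ?_ hL2.2.ge
    exact fun x hx => ⟨⟨hx.1, hLa x hx.1.1 hx.2⟩, hx.2⟩
  obtain ⟨P, hP, hPL, hPl⟩ := (hG.diff_maxLine hla').exists_mem_inter hL3
    (hG.maxLine_diff hlb' hla' (T.newLine_ne_newLine hla hlb).symm)
  exact hLb P ⟨hP.1.1.1, hP.1.2⟩ hPL hPl

end HasThreeMaxLines

theorem nodeLinesMiss_of {n : ℕ}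
    (hvertex : ∀ {X a b c L : Set Pt}, HasThreeMaxLines n X a b c → IsNodeLine n X L →
      ∀ {v w : Pt}, v ∈ X → v ∈ L → v ∈ a → v ∈ b → w ∈ X → w ∈ L → w ∈ c → False)
    (htrans : ∀ {X a b c L : Set Pt}, HasThreeMaxLines n X a b c → IsNodeLine n X L →
      ∀ {A B C : Pt}, A ∈ (X \ b) \ c → A ∈ L → A ∈ a → B ∈ (X \ a) \ c → B ∈ L → B ∈ b →
        C ∈ (X \ a) \ b → C ∈ L → C ∈ c → False) : NodeLinesMiss n := by
  intro X a b c L T hL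
  by_contra! h
  obtain ⟨⟨A, hA, hAL, hAa⟩, ⟨B, hB, hBL, hBb⟩, C, hC, hCL, hCc⟩ := h
  have hab : ∀ P ∈ X, P ∈ L → P ∈ a → P ∉ b := fun P hP hPL hPa hPb =>
    hvertex T hL hP hPL hPa hPb hC hCL hCc
  have hbc : ∀ P ∈ X, P ∈ L → P ∈ b → P ∉ c := fun P hP hPL hPb hPc =>
    hvertex T.rotate hL hP hPL hPb hPc hA hAL hAa
  have hca : ∀ P ∈ X, P ∈ L → P ∈ c → P ∉ a := fun P hP hPL hPc hPa =>
    hvertex T.rotate.rotate hL hP hPL hPc hPa hB hBL hBb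
  exact htrans T hL ⟨⟨hA, hab A hA hAL hAa⟩, fun h => hca A hA hAL h hAa⟩ hAL hAa
    ⟨⟨hB, fun h => hab B hB hBL h hBb⟩, hbc B hB hBL hBb⟩ hBL hBb
    ⟨⟨hC, hca C hC hCL hCc⟩, fun h => hbc C hC hCL h hCc⟩ hCL hCc

theorem GMUpTo.nodeLinesMiss {N : ℕ} (GM : GMUpTo N) (j : ℕ) (hj : j + 4 ≤ N) :
    NodeLinesMiss (j + 4) := by
  induction j with
  | zero =>
    exact nodeLinesMiss_of (fun T hL => T.vertex_base GM hj hL)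
      (fun T hL => T.transversal_base GM hj hL)
  | succ j ih =>
    have ih' := ih (by omega)
    exact nodeLinesMiss_of (fun T hL => T.vertex_step GM (by omega) ih' hL)
      (fun T hL => T.transversal_step GM (by omega) ih' hL)

theorem IsGC.useSet_eq {j : ℕ} {X M L : Set Pt} (hX : IsGC (j + 1) X)
    (hM : IsMaxLine (j + 1) X M) (hL : IsNewLine j X M L) :
    UseSet (j + 1) X L = (X \ M) \ L := by
  obtain ⟨f, hf, hMf⟩ := hM.1
  obtain ⟨g, hg, hLg⟩ := hL.1.1
  have hMf' : ∀ {x}, x ∈ M ↔ eval x f = 0 := by rw [hMf]; rfl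
  have hLg' : ∀ {x}, x ∈ L ↔ eval x g = 0 := by rw [hLg]; rfl
  ext A
  constructor
  · rintro ⟨hA, p, h, hp, hh, hLh, q, rfl⟩
    refine ⟨⟨hA, fun hAM => hM.not_dvd hL.2 hA hAM hp hh hLh (dvd_mul_right h q)⟩, fun hAL => ?_⟩
    have h1 := hp.2.1
    rw [hLh] at hAL
    rw [map_mul, show eval A h = 0 from hAL, zero_mul] at h1
    exact zero_ne_one h1
  · rintro ⟨⟨hA, hAM⟩, hAL⟩
    obtain ⟨p, hp, -⟩ := hX.2 A hA
    refine ⟨hA, p, g, hp, hg, hLg, ?_⟩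
    rcases eq_zero_or_exists_mul_of_vanishing (S := X ∩ M) hf hp.1 hM.2.ge
      (fun x hx => hMf'.1 hx.2) (by
        intro x hx
        refine hp.2.2 x hx.1 ?_
        rintro rfl
        exact hAM hx.2) with h0 | ⟨q, rfl, hq⟩
    · exact h0 ▸ dvd_zero g
    · refine Dvd.dvd.mul_left (dvd_of_vanishing (d := j) (S := X \ M ∩ L) hg (by omega)
        hL.1.2.ge (fun x hx => hLg'.1 hx.2) ?_) f
      intro x hx
      have h1 := hp.2.2 x hx.1.1 (by
        rintro rfl
        exact hAL hx.2)
      rw [map_mul] at h1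
      exact (mul_eq_zero.1 h1).resolve_left fun h2 => hx.1.2 (hMf'.2 h2)

theorem IsGC.ncard_useSet {j : ℕ} {X M L : Set Pt} (hX : IsGC (j + 2) X)
    (hM : IsMaxLine (j + 2) X M) (hL : IsNewLine (j + 1) X M L) :
    (UseSet (j + 2) X L).ncard = Nat.choose (j + 2) 2 := by
  rw [hX.useSet_eq hM hL, ((hX.diff_maxLine hM).diff_maxLine hL.1).1.1, Nat.choose_two_right,
    mul_comm]
  rfl

theorem IsNewLine.isNodeLine {j : ℕ} {X M L : Set Pt} (hL : IsNewLine j X M L) :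
    IsNodeLine (j + 1) X L := by
  refine ⟨hL.1.1, ?_⟩
  rw [← hL.1.2]
  congr 1
  ext x
  exact ⟨fun hx => ⟨⟨hx.1, hL.2 x hx.1 hx.2⟩, hx.2⟩, fun hx => ⟨hx.1.1, hx.2⟩⟩

theorem IsNodeLine.isNewLine {j : ℕ} {X M L : Set Pt} (hL : IsNodeLine (j + 1) X L)
    (h : ∀ x ∈ X, x ∈ L → x ∉ M) : IsNewLine j X M L := by
  refine ⟨⟨hL.1, ?_⟩, h⟩
  rw [← hL.2]
  congr 1
  ext x
  exact ⟨fun hx => ⟨hx.1.1, hx.2⟩, fun hx => ⟨⟨hx.1, h x hx.1 hx.2⟩, hx.2⟩⟩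

/-- Assuming the Gasca–Maeztu conjecture up to degree `n`, a `GC_n` set `X`
with `n ≥ 4` having exactly three maximal lines has exactly three `n`-node lines, each of
which is used by exactly `C(n,2)` nodes of `X`. -/
theorem three_maxLines_nNodeLines (n : ℕ) (hn : 4 ≤ n)
    (GM : ∀ k : ℕ, 1 ≤ k → k ≤ n → ∀ Y : Set Pt, IsGC k Y → ∃ M : Set Pt, IsMaxLine k Y M)
    (X : Set Pt) (hX : IsGC n X)
    (hmax : {M : Set Pt | IsMaxLine n X M}.ncard = 3) :
    {ℓ : Set Pt | IsNodeLine n X ℓ}.ncard = 3 ∧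
    ∀ ℓ : Set Pt, IsNodeLine n X ℓ → (UseSet n X ℓ).ncard = Nat.choose n 2 := by
  obtain ⟨j, rfl⟩ : ∃ j, n = j + 4 := ⟨n - 4, by omega⟩
  have GM' : GMUpTo (j + 4) := GM
  obtain ⟨a, b, c, hab, hac, hbc, habc⟩ := Set.ncard_eq_three.1 hmax
  have hiff : ∀ M, IsMaxLine (j + 4) X M ↔ M = a ∨ M = b ∨ M = c := fun M =>
    Set.ext_iff.1 habc M
  have T : HasThreeMaxLines (j + 4) X a b c :=
    ⟨hX, (hiff a).2 (by simp), (hiff b).2 (by simp), (hiff c).2 (by simp), hab, hac, hbc,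
      fun M hM => (hiff M).1 hM⟩
  obtain ⟨la, hla⟩ := T.exists_newLine GM' (by omega)
  obtain ⟨lb, hlb⟩ := T.rotate.exists_newLine GM' (by omega)
  obtain ⟨lc, hlc⟩ := T.rotate.rotate.exists_newLine GM' (by omega)
  have hcases : ∀ L, IsNodeLine (j + 4) X L → L = la ∨ L = lb ∨ L = lc := by
    intro L hL
    rcases GM'.nodeLinesMiss j le_rfl X a b c L T hL with h | h | h
    · exact Or.inl (GM'.newLine_unique (by omega) hX T.left (hL.isNewLine h) hla)
    · exact Or.inr (Or.inl (GM'.newLine_unique (by omega) hX T.mid (hL.isNewLine h) hlb))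
    · exact Or.inr (Or.inr (GM'.newLine_unique (by omega) hX T.right (hL.isNewLine h) hlc))
  constructor
  · refine Set.ncard_eq_three.2 ⟨la, lb, lc, T.newLine_ne_newLine hla hlb,
      (T.rotate.rotate.newLine_ne_newLine hlc hla).symm, T.rotate.newLine_ne_newLine hlb hlc, ?_⟩
    ext L
    refine ⟨hcases L, ?_⟩
    rintro (rfl | rfl | rfl)
    exacts [hla.isNodeLine, hlb.isNodeLine, hlc.isNodeLine]
  · intro L hL
    rcases hcases L hL with rfl | rfl | rfl
    exacts [hX.ncard_useSet T.left hla, hX.ncard_useSet T.mid hlb, hX.ncard_useSet T.right hlc]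
end

section
/- Let X be an n-poised set and let ℓ be an n-node line of X. Then: (i) |X_ℓ| ≤ binom(n,2); (ii) if |X_ℓ| ≥ binom(n-1,2) + 1, then |X_ℓ| = binom(n,2), X_ℓ is an (n−2)-poised set, and X_ℓ = X \ (ℓ ∪ M) for some maximal line M of X such that no node of X lies on both M and ℓ. -/
open MvPolynomial

open Finset in
/-- The number of exponent vectors of bivariate monomials of total degree at most `n`. -/
lemma card_finsupp_sum_le (n : ℕ) :
    Nat.card {s : Fin 2 →₀ ℕ | (s.sum fun _ e => e) ≤ n} = (n + 1) * (n + 2) / 2 := by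
  have e : {s : Fin 2 →₀ ℕ | (s.sum fun _ e => e) ≤ n} ≃
      ((range (n + 1)).sigma fun k => antidiagonal k) :=
    { toFun := fun s => ⟨⟨s.1 0 + s.1 1, (s.1 0, s.1 1)⟩, by
        have := s.2
        simp only [Set.mem_ofPred_eq, Finsupp.sum_fintype, Fin.sum_univ_two,
          implies_true] at this
        simp only [mem_sigma, mem_range, HasAntidiagonal.mem_antidiagonal, and_true]
        omega⟩
      invFun := fun t => ⟨Finsupp.equivFunOnFinite.symm ![t.1.2.1, t.1.2.2], by
        have := t.2
        simp only [mem_sigma, mem_range, HasAntidiagonal.mem_antidiagonal] at this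
        simp [Finsupp.sum_fintype]
        omega⟩
      left_inv := fun s => by
        ext i
        fin_cases i <;> simp
      right_inv := fun t => by
        obtain ⟨⟨k, a, b⟩, ht⟩ := t
        simp only [mem_sigma, mem_range, HasAntidiagonal.mem_antidiagonal] at ht
        obtain ⟨-, rfl⟩ := ht
        simp }
  rw [Nat.card_congr e, Nat.card_eq_fintype_card, Fintype.card_coe, card_sigma]
  simp only [Nat.card_antidiagonal]
  have h := sum_range_succ' (fun i => i) (n + 1)
  rw [add_zero] at h
  rw [← h, sum_range_id, mul_comm, Nat.add_sub_cancel]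

lemma finrank_restrictTotalDegree (n : ℕ) :
    Module.finrank ℝ (restrictTotalDegree (Fin 2) ℝ n) = (n + 1) * (n + 2) / 2 := by
  rw [← card_finsupp_sum_le]
  exact Module.finrank_eq_nat_card_basis (basisRestrictSupport ℝ _)

/-- Evaluation of the polynomials of degree at most `n` at the points of `Y`. -/
noncomputable def evalOn (n : ℕ) (Y : Finset Pt) :
    restrictTotalDegree (Fin 2) ℝ n →ₗ[ℝ] (Y → ℝ) where
  toFun p A := eval A.1 p.1
  map_add' p q := by ext; simp
  map_smul' c p := by ext; simp [smul_eval]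

lemma evalOn_injective {n : ℕ} {Y : Finset Pt}
    (h : ∀ q : BPoly, q.totalDegree ≤ n → (∀ A ∈ Y, eval A q = 0) → q = 0) :
    Function.Injective (evalOn n Y) := by
  rw [← LinearMap.ker_eq_bot, LinearMap.ker_eq_bot']
  intro p hp
  exact Subtype.ext (h p.1 ((mem_restrictTotalDegree _ _ _).1 p.2)
    fun A hA => congrFun hp ⟨A, hA⟩)

lemma isPoised_of_vanishing {n : ℕ} {Y : Finset Pt} (hcard : Y.card = (n + 1) * (n + 2) / 2)
    (h : ∀ q : BPoly, q.totalDegree ≤ n → (∀ A ∈ Y, eval A q = 0) → q = 0) :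
    IsPoised n (Y : Set Pt) := by
  refine ⟨by rw [Set.ncard_coe_finset, hcard], fun c => ?_⟩
  have hsurj : Function.Surjective (evalOn n Y) :=
    (LinearMap.injective_iff_surjective_of_finrank_eq_finrank
      (by rw [finrank_restrictTotalDegree]; simp [hcard])).1 (evalOn_injective h)
  obtain ⟨p, hp⟩ := hsurj fun A => c A.1
  refine ⟨p.1, ⟨(mem_restrictTotalDegree _ _ _).1 p.2, fun A hA => congrFun hp ⟨A, hA⟩⟩, ?_⟩
  rintro q ⟨hq, hqc⟩
  have hpq : evalOn n Y ⟨q, (mem_restrictTotalDegree _ _ _).2 hq⟩ = evalOn n Y p := by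
    rw [hp]
    ext A
    exact hqc A.1 A.2
  exact congrArg Subtype.val (evalOn_injective h hpq)

/-- If `Y` has one point more than the dimension of the space of polynomials of degree at most `m`
and no nonzero such polynomial vanishes on `Y`, then the evaluations at the points of `Y` satisfy a
nontrivial linear dependency, and every point of weight zero has a fundamental polynomial. -/
lemma exists_dependency {m : ℕ} {Y : Finset Pt} (hcard : Y.card = (m + 1) * (m + 2) / 2 + 1)
    (h : ∀ q : BPoly, q.totalDegree ≤ m → (∀ A ∈ Y, eval A q = 0) → q = 0) :
    ∃ w : Pt → ℝ, (∃ A ∈ Y, w A ≠ 0) ∧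
      (∀ q : BPoly, q.totalDegree ≤ m → ∑ A ∈ Y, w A * eval A q = 0) ∧
      ∀ A ∈ Y, w A = 0 → ∃ q : BPoly, q.totalDegree ≤ m ∧ eval A q = 1 ∧
        ∀ B ∈ Y, B ≠ A → eval B q = 0 := by
  classical
  have hrank : Module.finrank ℝ (LinearMap.range (evalOn m Y)) + 1 =
      Module.finrank ℝ (Y → ℝ) := by
    rw [LinearMap.finrank_range_of_inj (evalOn_injective h), finrank_restrictTotalDegree]
    simp [hcard]
  obtain ⟨φ, hφ, hle⟩ := (LinearMap.range (evalOn m Y)).exists_le_ker_of_lt_top <| by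
    rw [lt_top_iff_ne_top]
    intro htop
    rw [htop, finrank_top] at hrank
    omega
  have heq : LinearMap.range (evalOn m Y) = LinearMap.ker φ := by
    refine Submodule.eq_of_le_of_finrank_eq hle ?_
    have := Module.Dual.finrank_ker_add_one_of_ne_zero hφ
    omega
  refine ⟨fun A => if hA : A ∈ Y then φ (Pi.single ⟨A, hA⟩ 1) else 0, ?_, fun q hq => ?_,
    fun A hA hw => ?_⟩
  · by_contra! hzero
    refine hφ (LinearMap.pi_ext' fun A => LinearMap.ext_ring ?_)
    simpa [A.2] using hzero A.1 A.2
  · have hmem : φ (evalOn m Y ⟨q, (mem_restrictTotalDegree _ _ _).2 hq⟩) = 0 :=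
      hle ⟨_, rfl⟩
    rw [LinearMap.pi_apply_eq_sum_univ] at hmem
    dsimp only
    rw [← Finset.sum_coe_sort Y, ← hmem]
    refine Finset.sum_congr rfl fun A _ => ?_
    rw [dif_pos A.2, mul_comm, smul_eq_mul]
    congr 2
    ext B
    simp [Pi.single_apply, eq_comm]
  · simp only [dif_pos hA] at hw
    have hmem : (Pi.single ⟨A, hA⟩ 1 : Y → ℝ) ∈ LinearMap.range (evalOn m Y) := by
      rw [heq]; exact hw
    obtain ⟨q, hq⟩ := hmem
    refine ⟨q.1, (mem_restrictTotalDegree _ _ _).1 q.2, ?_, fun B hB hBA => ?_⟩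
    · exact (congrFun hq ⟨A, hA⟩).trans (by simp)
    · exact (congrFun hq ⟨B, hB⟩).trans (by simp [hBA])

lemma totalDegree_eq_one_of_eval {f : BPoly} (hf : f.totalDegree ≤ 1) {A B : Pt}
    (hA : eval A f = 0) (hB : eval B f ≠ 0) : f.totalDegree = 1 := by
  by_contra hne
  have h0 : f.totalDegree = 0 := by omega
  rw [totalDegree_eq_zero_iff_eq_C] at h0
  rw [h0, eval_C] at hA hB
  exact hB hA

lemma exists_line_separating {A B : Pt} (hAB : A ≠ B) :
    ∃ f : BPoly, f.totalDegree = 1 ∧ eval A f = 0 ∧ eval B f ≠ 0 := by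
  obtain ⟨i, hi⟩ := Function.ne_iff.1 hAB
  have hA : eval A (X i - C (A i) : BPoly) = 0 := by simp
  have hB : eval B (X i - C (A i) : BPoly) ≠ 0 := by simpa [sub_eq_zero] using hi.symm
  exact ⟨_, totalDegree_eq_one_of_eval
    ((totalDegree_sub_C_le _ _).trans (totalDegree_X i).le) hA hB, hA, hB⟩

lemma exists_line_through {A B : Pt} (hAB : A ≠ B) :
    ∃ f : BPoly, f.totalDegree = 1 ∧ eval A f = 0 ∧ eval B f = 0 := by
  let f : BPoly := C (B 1 - A 1) * (X 0 - C (A 0)) - C (B 0 - A 0) * (X 1 - C (A 1))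
  have hf : f.totalDegree ≤ 1 := by
    have h : ∀ (c d : ℝ) (i : Fin 2), (C c * (X i - C d) : BPoly).totalDegree ≤ 1 :=
      fun c d i => (totalDegree_mul _ _).trans <| by
        rw [totalDegree_C, zero_add]
        exact (totalDegree_sub_C_le _ _).trans (totalDegree_X i).le
    exact (totalDegree_sub _ _).trans (max_le (h _ _ _) (h _ _ _))
  have hA : eval A f = 0 := by simp [f]
  have hB : eval B f = 0 := by simp [f]; ring
  have hP : eval ![A 0 + (B 1 - A 1), A 1 - (B 0 - A 0)] f ≠ 0 := by
    intro h
    simp [f] at h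
    have h0 : B 0 - A 0 = 0 := by nlinarith [sq_nonneg (B 0 - A 0), sq_nonneg (B 1 - A 1)]
    have h1 : B 1 - A 1 = 0 := by nlinarith [sq_nonneg (B 0 - A 0), sq_nonneg (B 1 - A 1)]
    apply hAB
    ext i
    fin_cases i
    · simp; linarith
    · simp; linarith
  exact ⟨f, totalDegree_eq_one_of_eval hf hA hP, hA, hB⟩

/-- `w` is the weight vector of a linear dependency, with all weights nonzero, between the
evaluations at the points of `D` on the polynomials of degree at most `m`. -/
def IsDependency (m : ℕ) (D : Finset Pt) (w : Pt → ℝ) : Prop :=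
  (∀ A ∈ D, w A ≠ 0) ∧
    ∀ q : BPoly, q.totalDegree ≤ m → ∑ A ∈ D, w A * eval A q = 0

/-- The points of `D` at which `f` does not vanish. -/
noncomputable def offZeros (D : Finset Pt) (f : BPoly) : Finset Pt := {A ∈ D | eval A f ≠ 0}

lemma mem_offZeros {D : Finset Pt} {f : BPoly} {A : Pt} :
    A ∈ offZeros D f ↔ A ∈ D ∧ eval A f ≠ 0 := Finset.mem_filter

lemma card_zeros_add_card_offZeros (D : Finset Pt) (f : BPoly) :
    ({A ∈ D | eval A f = 0}).card + (offZeros D f).card = D.card :=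
  Finset.card_filter_add_card_filter_not _

/-- Multiplying the weights by the values of an affine function `f` lowers the degree by one and
removes the points of the line `f = 0`. -/
lemma IsDependency.off_line {m : ℕ} {D : Finset Pt} {w : Pt → ℝ}
    (h : IsDependency (m + 1) D w) {f : BPoly} (hf : f.totalDegree = 1) :
    IsDependency m (offZeros D f) fun A => w A * eval A f := by
  refine ⟨fun A hA => ?_, fun q hq => ?_⟩
  · rw [mem_offZeros] at hA
    exact mul_ne_zero (h.1 A hA.1) hA.2
  · have hdeg : (f * q).totalDegree ≤ m + 1 := (totalDegree_mul _ _).trans (by omega)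
    rw [← h.2 _ hdeg, offZeros, Finset.sum_filter]
    refine Finset.sum_congr rfl fun A _ => ?_
    split_ifs with hA
    · rw [map_mul, mul_assoc]
    · rw [map_mul, not_not.1 hA, zero_mul, mul_zero]

lemma IsDependency.one_lt_card {m : ℕ} {D : Finset Pt} {w : Pt → ℝ}
    (h : IsDependency m D w) (hD : D.Nonempty) : 1 < D.card := by
  by_contra hle
  have h1 : D.card = 1 := by have := hD.card_pos; omega
  obtain ⟨A, rfl⟩ := Finset.card_eq_one.1 h1
  have := h.2 1 (by simp)
  simp at this
  exact h.1 A (by simp) this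

lemma IsDependency.add_two_le_card {m : ℕ} {D : Finset Pt} {w : Pt → ℝ}
    (h : IsDependency m D w) (hD : D.Nonempty) : m + 2 ≤ D.card := by
  induction m generalizing D w with
  | zero => exact h.one_lt_card hD
  | succ m ih =>
    obtain ⟨A, hA, B, hB, hAB⟩ := Finset.one_lt_card.1 (h.one_lt_card hD)
    obtain ⟨f, hf, hfA, hfB⟩ := exists_line_separating hAB
    have h1 := ih (h.off_line hf) ⟨B, mem_offZeros.2 ⟨hB, hfB⟩⟩
    have h2 : (offZeros D f).card < D.card := Finset.card_lt_card <|
      Finset.filter_ssubset.2 ⟨A, hA, not_not.2 hfA⟩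
    omega

/-- A dependency of degree `m` between at most `2 * m + 1` points is supported on a line. -/
lemma IsDependency.collinear {m : ℕ} {D : Finset Pt} {w : Pt → ℝ}
    (h : IsDependency m D w) (hcard : D.card ≤ 2 * m + 1) :
    ∃ f : BPoly, f.totalDegree = 1 ∧ ∀ A ∈ D, eval A f = 0 := by
  induction m generalizing D w with
  | zero =>
    refine ⟨X 0, totalDegree_X 0, fun A hA => ?_⟩
    have := h.one_lt_card ⟨A, hA⟩
    omega
  | succ m ih =>
    rcases D.eq_empty_or_nonempty with rfl | hD
    · exact ⟨X 0, totalDegree_X 0, by simp⟩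
    obtain ⟨A, hA, B, hB, hAB⟩ := Finset.one_lt_card.1 (h.one_lt_card hD)
    obtain ⟨f, hf, hfA, hfB⟩ := exists_line_through hAB
    have h2 : 2 ≤ ({P ∈ D | eval P f = 0}).card :=
      Finset.one_lt_card.2 ⟨A, by simp [hA, hfA], B, by simp [hB, hfB], hAB⟩
    obtain ⟨g, hg, hgD⟩ := ih (h.off_line hf) (by have := card_zeros_add_card_offZeros D f; omega)
    rcases Finset.eq_empty_or_nonempty (offZeros D f) with he | hne
    · exact ⟨f, hf, fun P hP => by simpa using Finset.filter_eq_empty_iff.1 he hP⟩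
    refine ⟨g, hg, fun P hP => by_contra fun hgP => ?_⟩
    have h3 := (h.off_line hf).add_two_le_card hne
    have h4 := (h.off_line hg).add_two_le_card ⟨P, mem_offZeros.2 ⟨hP, hgP⟩⟩
    have h5 : (offZeros D f).card ≤ ({P ∈ D | eval P g = 0}).card :=
      Finset.card_le_card fun Q hQ =>
        Finset.mem_filter.2 ⟨(mem_offZeros.1 hQ).1, hgD Q hQ⟩
    have := card_zeros_add_card_offZeros D g
    omega

lemma exists_coeffs_of_totalDegree_eq_one {f : BPoly} (hf : f.totalDegree = 1) :
    ∃ a b c : ℝ, (a ≠ 0 ∨ b ≠ 0) ∧ ∀ P : Pt, eval P f = a * P 0 + b * P 1 + c := by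
  have hform : f = C (coeff (Finsupp.single 0 1) f) * X 0 + C (coeff (Finsupp.single 1 1) f) * X 1 +
      C (coeff 0 f) := by
    ext d
    by_cases hd : 1 < d.degree
    · have h0 : coeff d f = 0 := coeff_eq_zero_of_totalDegree_lt <| by
        rw [hf]; exact hd
      have h1 : (0 : Fin 2 →₀ ℕ) ≠ d := by rintro rfl; simp at hd
      have h2 : ∀ i : Fin 2, Finsupp.single i 1 ≠ d := by rintro i rfl; simp at hd
      simp [h0, coeff_C_mul, coeff_X, coeff_C, h1, h2]
    · rw [Finsupp.degree_eq_sum, Fin.sum_univ_two] at hd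
      have hcases : d = 0 ∨ d = Finsupp.single 0 1 ∨ d = Finsupp.single 1 1 := by
        have : (d 0 = 0 ∧ d 1 = 0) ∨ (d 0 = 1 ∧ d 1 = 0) ∨ (d 0 = 0 ∧ d 1 = 1) := by omega
        rcases this with h | h | h
        · left; ext i; fin_cases i <;> simp [h]
        · right; left; ext i; fin_cases i <;> simp [h]
        · right; right; ext i; fin_cases i <;> simp [h]
      rcases hcases with rfl | rfl | rfl <;>
        simp [coeff_C_mul, coeff_X, coeff_C, Finsupp.single_left_inj, eq_comm]
  refine ⟨coeff (Finsupp.single 0 1) f, coeff (Finsupp.single 1 1) f, coeff 0 f, ?_,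
    fun P => (congrArg (eval P) hform).trans <| by simp only [map_add, map_mul, eval_C, eval_X]⟩
  by_contra! h
  rw [h.1, h.2] at hform
  rw [hform] at hf
  simp at hf

/-- A polynomial of degree at most `n` that vanishes at more than `n` points of a line vanishes
on the line. -/
lemma eval_eq_zero_of_card_lt {n : ℕ} {p f : BPoly} (hp : p.totalDegree ≤ n)
    (hf : f.totalDegree = 1) {S : Finset Pt} (hS : ∀ B ∈ S, eval B f = 0 ∧ eval B p = 0)
    (hcard : n < S.card) {A : Pt} (hA : eval A f = 0) : eval A p = 0 := by
  obtain ⟨a, b, c, hab, hform⟩ := exists_coeffs_of_totalDegree_eq_one hf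
  have hpos : a ^ 2 + b ^ 2 ≠ 0 := by
    rcases hab with h | h <;> positivity
  let v : Pt := ![-b, a]
  let t : Pt → ℝ := fun B => (a * (B 1 - A 1) - b * (B 0 - A 0)) / (a ^ 2 + b ^ 2)
  have ht : ∀ B, eval B f = 0 → (fun i => A i + v i * t B) = B := by
    intro B hB
    rw [hform] at hA hB
    have h : a * (B 0 - A 0) = - b * (B 1 - A 1) := by linarith
    ext i
    fin_cases i
    · simp [v, t]
      field_simp
      linear_combination -a * h
    · simp [v, t]
      field_simp
      linear_combination -b * h
  let r : Polynomial ℝ := aeval (fun i => Polynomial.C (A i) + Polynomial.C (v i) * Polynomial.X) p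
  have hr : ∀ s, r.eval s = eval (fun i => A i + v i * s) p := by
    intro s
    have hid : (Polynomial.evalRingHom s).comp Polynomial.C = RingHom.id ℝ := by
      ext; simp
    simp [r, aeval_def, polynomial_eval_eval₂, hid]
  have hdeg : r.natDegree ≤ n := by
    refine (aeval_natDegree_le p hp _ fun i => ?_).trans_eq (mul_one n)
    rw [Polynomial.natDegree_C_add]
    exact (Polynomial.natDegree_C_mul_le _ _).trans Polynomial.natDegree_X_le
  have hr0 : r = 0 := by
    refine Polynomial.eq_zero_of_natDegree_lt_card_of_eval_eq_zero r
      (f := fun B : S => t B.1) (fun B B' h => ?_) (fun B => ?_) (by simpa using hdeg.trans_lt hcard)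
    · refine Subtype.ext ?_
      rw [← ht B.1 (hS _ B.2).1, ← ht B'.1 (hS _ B'.2).1]
      dsimp only at h
      rw [h]
    · rw [hr, ht _ (hS _ B.2).1, (hS _ B.2).2]
  have h0 := hr 0
  rw [hr0] at h0
  simpa using h0.symm

lemma IsPoised.eq_zero {n : ℕ} {X : Set Pt} (hX : IsPoised n X) {p : BPoly}
    (hp : p.totalDegree ≤ n) (h : ∀ A ∈ X, eval A p = 0) : p = 0 :=
  (hX.2 fun _ => 0).unique ⟨hp, h⟩ ⟨by simp, by simp⟩

lemma IsPoised.card_line_le {n : ℕ} {X : Finset Pt} (hX : IsPoised n (X : Set Pt)) {f : BPoly}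
    (hf : f.totalDegree = 1) : ({A ∈ X | eval A f = 0}).card ≤ n + 1 := by
  classical
  by_contra! hlt
  obtain ⟨A, hA⟩ := Finset.card_pos.1 ((Nat.zero_le _).trans_lt hlt)
  obtain ⟨p, ⟨hp, hval⟩, -⟩ := hX.2 fun B => if B = A then 1 else 0
  have hA' := Finset.mem_filter.1 hA
  have h0 : eval A p = 0 := by
    refine eval_eq_zero_of_card_lt hp hf (S := ({A ∈ X | eval A f = 0}).erase A)
      (fun B hB => ?_) ?_ hA'.2
    · obtain ⟨hne, hB⟩ := Finset.mem_erase.1 hB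
      obtain ⟨hBX, hBf⟩ := Finset.mem_filter.1 hB
      exact ⟨hBf, by rw [hval B hBX, if_neg hne]⟩
    · rw [Finset.card_erase_of_mem hA]
      omega
  rw [hval A hA'.1, if_pos rfl] at h0
  exact one_ne_zero h0

lemma useSet_zero (X L : Set Pt) : UseSet 0 X L = ∅ := by
  refine Set.eq_empty_of_forall_notMem ?_
  rintro A ⟨-, p, f, ⟨hp, hA, -⟩, hf, -, hdvd⟩
  have hp0 : p ≠ 0 := by rintro rfl; simp at hA
  have := totalDegree_le_of_dvd_of_isDomain hdvd hp0
  omega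

/-- A node uses the line `f = 0` iff it is off the line and has weight zero in the dependency
between the nodes off the line. -/
lemma mem_useSet_iff {m : ℕ} {X : Finset Pt} {f : BPoly} (hf : f.totalDegree = 1) {w : Pt → ℝ}
    (hw : ∀ q : BPoly, q.totalDegree ≤ m → ∑ A ∈ offZeros X f, w A * eval A q = 0)
    (hfund : ∀ A ∈ offZeros X f, w A = 0 → ∃ q : BPoly, q.totalDegree ≤ m ∧ eval A q = 1 ∧
      ∀ B ∈ offZeros X f, B ≠ A → eval B q = 0) {A : Pt} :
    A ∈ UseSet (m + 1) (X : Set Pt) {x | eval x f = 0} ↔ A ∈ offZeros X f ∧ w A = 0 := by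
  constructor
  · rintro ⟨hAX, p, g, ⟨hp, hpA, hpB⟩, hg, hfg, q, rfl⟩
    have hzero : ∀ B, eval B f = 0 ↔ eval B g = 0 := fun B => Set.ext_iff.1 hfg B
    rw [map_mul] at hpA
    have hgA : eval A g ≠ 0 := left_ne_zero_of_mul_eq_one hpA
    have hqA : eval A q ≠ 0 := right_ne_zero_of_mul_eq_one hpA
    have hA : A ∈ offZeros X f := mem_offZeros.2 ⟨hAX, (hzero A).not.2 hgA⟩
    refine ⟨hA, ?_⟩
    have hq : q.totalDegree ≤ m := by
      rw [totalDegree_mul_of_isDomain (by rintro rfl; simp at hgA)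
        (by rintro rfl; simp at hqA)] at hp
      omega
    have hsum := hw q hq
    rw [Finset.sum_eq_single_of_mem A hA fun B hB hBA => ?_] at hsum
    · exact (mul_eq_zero.1 hsum).resolve_right hqA
    · obtain ⟨hBX, hBf⟩ := mem_offZeros.1 hB
      have := hpB B hBX hBA
      rw [map_mul] at this
      rw [(mul_eq_zero.1 this).resolve_left ((hzero B).not.1 hBf), mul_zero]
  · rintro ⟨hA, hwA⟩
    obtain ⟨q, hq, hqA, hqB⟩ := hfund A hA hwA
    obtain ⟨hAX, hAf⟩ := mem_offZeros.1 hA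
    refine ⟨hAX, f * (C (eval A f)⁻¹ * q), f, ⟨?_, ?_, fun B hB hBA => ?_⟩, hf, rfl,
      Dvd.intro _ rfl⟩
    · refine (totalDegree_mul _ _).trans ?_
      have : (C (eval A f)⁻¹ * q : BPoly).totalDegree ≤ m :=
        (totalDegree_mul _ _).trans (by rw [totalDegree_C, zero_add]; exact hq)
      omega
    · simp [hqA, hAf]
    · by_cases hBf : eval B f = 0
      · simp [hBf]
      · simp [hqB B (mem_offZeros.2 ⟨hB, hBf⟩) hBA]

/-- Let `X` be `n`-poised and `ℓ` an `n`-node line. Then (i) `|X_ℓ| ≤ C(n,2)`;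
(ii) if `|X_ℓ| ≥ C(n-1,2) + 1` then `|X_ℓ| = C(n,2)`, `X_ℓ` is `(n-2)`-poised, and
`X_ℓ = X \ (ℓ ∪ M)` for a maximal line `M` with `M ∩ ℓ ∩ X = ∅`. -/
theorem nNodeLine_useSet_card_bounds (n : ℕ) (X ℓ : Set Pt)
    (hX : IsPoised n X) (hℓ : IsNodeLine n X ℓ) :
    (UseSet n X ℓ).ncard ≤ Nat.choose n 2 ∧
    (Nat.choose (n - 1) 2 + 1 ≤ (UseSet n X ℓ).ncard →
      (UseSet n X ℓ).ncard = Nat.choose n 2 ∧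
      IsPoised (n - 2) (UseSet n X ℓ) ∧
      ∃ M : Set Pt, IsMaxLine n X M ∧ M ∩ ℓ ∩ X = ∅ ∧
        UseSet n X ℓ = X \ (ℓ ∪ M)) := by
  classical
  have hfin : X.Finite := Set.finite_of_ncard_pos <| by
    rw [hX.1]
    exact Nat.div_pos (by nlinarith) two_pos
  obtain ⟨X, rfl⟩ := hfin.exists_finset_coe
  cases n with
  | zero => simp [useSet_zero]
  | succ m =>
  obtain ⟨⟨f, hf, rfl⟩, hcardℓ⟩ := hℓ
  have hXℓ : ({A ∈ X | eval A f = 0}).card = m + 1 := by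
    rw [← hcardℓ, ← Set.ncard_coe_finset, Finset.coe_filter]
    rfl
  have hXcard : X.card = (m + 1 + 1) * (m + 1 + 2) / 2 := by
    rw [← hX.1, Set.ncard_coe_finset]
  have hsplit := card_zeros_add_card_offZeros X f
  have hm : (m + 1 + 1) * (m + 1 + 2) = (m + 1) * (m + 2) + 2 * (m + 2) := by ring
  have hYcard : (offZeros X f).card = (m + 1) * (m + 2) / 2 + 1 := by omega
  have hchoose : Nat.choose (m + 1) 2 + m + 1 = (m + 1) * (m + 2) / 2 := by
    have h1 : (m + 1) * (m + 2) = (m + 1) * m + 2 * (m + 1) := by ring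
    rw [Nat.choose_two_right, Nat.add_sub_cancel]
    omega
  have hchoose' : Nat.choose (m + 1) 2 = Nat.choose m 2 + m := by
    rw [Nat.choose_succ_succ' m 1, Nat.choose_one_right, add_comm]
  obtain ⟨w, ⟨A₀, hA₀, hwA₀⟩, hw, hfund⟩ := exists_dependency hYcard fun q hq hqY => by
    have hzero : f * q = 0 := hX.eq_zero ((totalDegree_mul _ _).trans (by omega)) fun A hA => by
      by_cases hAf : eval A f = 0
      · rw [map_mul, hAf, zero_mul]
      · rw [map_mul, hqY A (mem_offZeros.2 ⟨hA, hAf⟩), mul_zero]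
    refine (mul_eq_zero.1 hzero).resolve_left ?_
    rintro rfl
    simp at hf
  set D : Finset Pt := {A ∈ offZeros X f | w A ≠ 0} with hD
  have hdep : IsDependency m D w := by
    refine ⟨fun A hA => (Finset.mem_filter.1 hA).2, fun q hq => ?_⟩
    rw [← hw q hq]
    refine Finset.sum_subset (Finset.filter_subset _ _) fun A hA hAD => ?_
    rw [not_not.1 fun h => hAD (Finset.mem_filter.2 ⟨hA, h⟩), zero_mul]
  have huse : UseSet (m + 1) (X : Set Pt) {x | eval x f = 0} =
      (({A ∈ offZeros X f | w A = 0} : Finset Pt) : Set Pt) := by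
    ext A
    rw [mem_useSet_iff hf hw hfund, Finset.mem_coe, Finset.mem_filter]
  have hsum : ({A ∈ offZeros X f | w A = 0}).card + D.card = (offZeros X f).card :=
    Finset.card_filter_add_card_filter_not _
  have hDcard := hdep.add_two_le_card ⟨A₀, Finset.mem_filter.2 ⟨hA₀, hwA₀⟩⟩
  rw [huse, Set.ncard_coe_finset]
  refine ⟨by omega, fun hlarge => ?_⟩
  rw [Nat.add_sub_cancel] at hlarge
  obtain ⟨g, hg, hgD⟩ := hdep.collinear (by omega)
  have hDsub : D ⊆ {A ∈ X | eval A g = 0} := fun A hA =>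
    Finset.mem_filter.2 ⟨(mem_offZeros.1 (Finset.mem_filter.1 hA).1).1, hgD A hA⟩
  have hgcard := hX.card_line_le hg
  have hDeq : D = {A ∈ X | eval A g = 0} := Finset.eq_of_subset_of_card_le hDsub (by omega)
  have hDg : ∀ A ∈ X, eval A g = 0 ↔ eval A f ≠ 0 ∧ w A ≠ 0 := fun A hA => by
    have := Finset.ext_iff.1 hDeq A
    simpa [hD, mem_offZeros, hA] using this.symm
  have hUcard : ({A ∈ offZeros X f | w A = 0}).card = Nat.choose (m + 1) 2 := by
    rw [← hDeq] at hgcard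
    omega
  refine ⟨hUcard, ?_, {x | eval x g = 0}, ⟨⟨g, hg, rfl⟩, ?_⟩, ?_, ?_⟩
  · obtain ⟨k, rfl⟩ : ∃ k, m = k + 1 := Nat.exists_eq_succ_of_ne_zero (by omega)
    have hk : k + 1 + 1 - 2 = k := rfl
    rw [hk]
    refine isPoised_of_vanishing ?_ fun q hq hqU => ?_
    · rw [hUcard, Nat.choose_two_right]
      rw [Nat.add_sub_cancel, mul_comm]
    · have hzero : f * (g * q) = 0 := by
        refine hX.eq_zero ?_ fun A hA => ?_
        · have h1 := totalDegree_mul g q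
          have h2 := totalDegree_mul f (g * q)
          omega
        · rw [map_mul, map_mul]
          by_cases hAf : eval A f = 0
          · rw [hAf, zero_mul]
          by_cases hwA : w A = 0
          · rw [hqU A (Finset.mem_filter.2 ⟨mem_offZeros.2 ⟨hA, hAf⟩, hwA⟩), mul_zero, mul_zero]
          · rw [(hDg A hA).2 ⟨hAf, hwA⟩, zero_mul, mul_zero]
      have hf0 : f ≠ 0 := by rintro rfl; simp at hf
      have hg0 : g ≠ 0 := by rintro rfl; simp at hg
      simpa [hf0, hg0] using hzero
  · have hcoe : (X : Set Pt) ∩ {x | eval x g = 0} = (D : Set Pt) := by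
      rw [hDeq, Finset.coe_filter]
      rfl
    rw [← hDeq] at hgcard
    rw [hcoe, Set.ncard_coe_finset]
    omega
  · refine Set.eq_empty_of_forall_notMem ?_
    rintro A ⟨⟨hAg, hAf⟩, hA⟩
    exact ((hDg A hA).1 hAg).1 hAf
  · ext A
    by_cases hA : A ∈ X
    · have := hDg A hA
      simp only [Finset.coe_filter, mem_offZeros, Set.mem_ofPred_eq, Set.mem_sdiff, Finset.mem_coe,
        Set.mem_union, this]
      tauto
    · simp [mem_offZeros, hA]
end
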